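/- Let (X₁,μ₁), (X₂,μ₂) be standard measure spaces and κ ⊆ X₁×X₂ be an operator synthetic ω-closed set. If the masa-bimodule M_max(κ) possesses property S_σ, then ρ(κ×λ) is operator synthetic for every operator synthetic ω-closed set λ ⊆ Y₁×Y₂, for all standard measure spaces (Y₁,ν₁), (Y₂,ν₂). -/

import Mathlib

open scoped ComplexInnerProductSpace Pointwise
open Set MeasureTheory

noncomputable section

namespace OpSynth

/-! ### The σ-weak (weak*) topology on `B(H,K)` -/

/-- The σ-weak (weak*) topology on the space of bounded operators between Hilbert
spaces: the initial topology with respect to the functionals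
`T ↦ ∑' n, ⟪η n, T (ξ n)⟫` associated to square-summable sequences `ξ`, `η`.
This is the weak* topology arising from the identification of `B(H,K)` with the
dual of the trace class operators. -/
def sigmaWeak (H K : Type*) [NormedAddCommGroup H] [InnerProductSpace ℂ H]
    [NormedAddCommGroup K] [InnerProductSpace ℂ K] :
    TopologicalSpace (H →L[ℂ] K) :=
  ⨅ (ξ : ℕ → H) (η : ℕ → K) (_ : Summable fun n => ‖ξ n‖ ^ 2)
    (_ : Summable fun n => ‖η n‖ ^ 2),
    TopologicalSpace.induced
      (fun T : H →L[ℂ] K => ∑' n, ⟪η n, T (ξ n)⟫) inferInstance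

section Basic

variable {H K H₁ H₂ H₃ K₁ K₂ T₁ T₂ : Type*}
  [NormedAddCommGroup H] [InnerProductSpace ℂ H]
  [NormedAddCommGroup K] [InnerProductSpace ℂ K]
  [NormedAddCommGroup H₁] [InnerProductSpace ℂ H₁]
  [NormedAddCommGroup H₂] [InnerProductSpace ℂ H₂]
  [NormedAddCommGroup H₃] [InnerProductSpace ℂ H₃]
  [NormedAddCommGroup K₁] [InnerProductSpace ℂ K₁]
  [NormedAddCommGroup K₂] [InnerProductSpace ℂ K₂]
  [NormedAddCommGroup T₁] [InnerProductSpace ℂ T₁]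
  [NormedAddCommGroup T₂] [InnerProductSpace ℂ T₂]

/-- A set of operators is weak* closed if it is closed in the σ-weak topology. -/
def WkClosed (S : Set (H →L[ℂ] K)) : Prop :=
  @IsClosed _ (sigmaWeak H K) S

/-- The weak* closure of a set of operators. -/
def wkClosure (S : Set (H →L[ℂ] K)) : Set (H →L[ℂ] K) :=
  @closure _ (sigmaWeak H K) S

/-- A weak* closed (linear) subspace of `B(H,K)`. -/
def IsWkClosedSubspace (S : Set (H →L[ℂ] K)) : Prop :=
  (∃ M : Submodule ℂ (H →L[ℂ] K), (M : Set (H →L[ℂ] K)) = S) ∧ WkClosed S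

/-- A map between operator spaces is weak* continuous if it is continuous with
respect to the σ-weak topologies. -/
def WkContinuous (φ : (H₁ →L[ℂ] H₂) → (K₁ →L[ℂ] K₂)) : Prop :=
  @Continuous _ _ (sigmaWeak H₁ H₂) (sigmaWeak K₁ K₂) φ

/-- The norm of an `n × n` matrix of operators, viewed as an operator on the
column Hilbert space `ℓ²(Fin n, H)`: the supremum over the unit ball of the
ℓ²-norm of the image. -/
def blockNorm {n : ℕ} (M : Matrix (Fin n) (Fin n) (H →L[ℂ] K)) : ℝ :=
  sSup { r | ∃ v : Fin n → H, (∑ j, ‖v j‖ ^ 2) ≤ 1 ∧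
    r = Real.sqrt (∑ i, ‖∑ j, M i j (v j)‖ ^ 2) }

/-- A map `φ : B(H₁,H₂) → B(K₁,K₂)` is completely bounded if its matrix
amplifications are uniformly bounded. -/
def CompletelyBounded (φ : (H₁ →L[ℂ] H₂) → (K₁ →L[ℂ] K₂)) : Prop :=
  ∃ C : ℝ, 0 ≤ C ∧ ∀ (n : ℕ) (M : Matrix (Fin n) (Fin n) (H₁ →L[ℂ] H₂)),
    blockNorm (M.map φ) ≤ C * blockNorm M

/-- `t : H → K → T₁` realizes `T₁` as the Hilbertian tensor product `H ⊗ K`: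
`t` is bilinear, multiplicative for inner products, and has total range. -/
def IsTensorEmbedding (t : H → K → T₁) : Prop :=
  (∀ x x' y, t (x + x') y = t x y + t x' y) ∧
  (∀ x y y', t x (y + y') = t x y + t x y') ∧
  (∀ (c : ℂ) x y, t (c • x) y = c • t x y) ∧
  (∀ (c : ℂ) x y, t x (c • y) = c • t x y) ∧
  (∀ x x' y y', ⟪t x y, t x' y'⟫ = ⟪x, x'⟫ * ⟪y, y'⟫) ∧
  (Submodule.span ℂ { z | ∃ x y, z = t x y }).topologicalClosure = ⊤

/-- `W` is the elementary tensor `S ⊗ R` of the operators `S` and `R`, relative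
to the tensor product realizations `t₁`, `t₂`. -/
def IsElemTensor (t₁ : H₁ → K₁ → T₁) (t₂ : H₂ → K₂ → T₂)
    (W : T₁ →L[ℂ] T₂) (S : H₁ →L[ℂ] H₂) (R : K₁ →L[ℂ] K₂) : Prop :=
  ∀ x y, W (t₁ x y) = t₂ (S x) (R y)

/-- The weak* closed tensor product `V ⊗̄ U`: the weak* closed subspace generated
by the elementary tensors `S ⊗ R` with `S ∈ V`, `R ∈ U`. -/
def wTensor (t₁ : H₁ → K₁ → T₁) (t₂ : H₂ → K₂ → T₂)
    (V : Set (H₁ →L[ℂ] H₂)) (U : Set (K₁ →L[ℂ] K₂)) : Set (T₁ →L[ℂ] T₂) :=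
  wkClosure ↑(Submodule.span ℂ
    { W : T₁ →L[ℂ] T₂ | ∃ S ∈ V, ∃ R ∈ U, IsElemTensor t₁ t₂ W S R })

/-- The Fubini product `F(V,U) = (V ⊗̄ B(K₁,K₂)) ∩ (B(H₁,H₂) ⊗̄ U)`. -/
def Fubini (t₁ : H₁ → K₁ → T₁) (t₂ : H₂ → K₂ → T₂)
    (V : Set (H₁ →L[ℂ] H₂)) (U : Set (K₁ →L[ℂ] K₂)) : Set (T₁ →L[ℂ] T₂) :=
  wTensor t₁ t₂ V univ ∩ wTensor t₁ t₂ univ U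

/-- Sum of finitely many subsets of an additive monoid. -/
def setSum {α : Type*} [AddCommMonoid α] {n : ℕ} (S : Fin n → Set α) : Set α :=
  { x | ∃ f : Fin n → α, (∀ i, f i ∈ S i) ∧ x = ∑ i, f i }

/-- The reflexive hull `Ref W = {T : Tx ∈ closure (W x) for all x}`. -/
def RefHull (W : Set (H →L[ℂ] K)) : Set (H →L[ℂ] K) :=
  { T | ∀ x : H, T x ∈ closure ((fun S : H →L[ℂ] K => S x) '' W) }

end Basic

/-- Property `S_σ`: `F(V,U) = V ⊗̄ U` for every weak* closed subspace `U` of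
`B(K₁,K₂)`, all Hilbert spaces `K₁`, `K₂`, and all realizations of the
corresponding Hilbertian tensor products. -/
def HasSsigma {H₁ H₂ : Type*}
    [NormedAddCommGroup H₁] [InnerProductSpace ℂ H₁]
    [NormedAddCommGroup H₂] [InnerProductSpace ℂ H₂]
    (V : Set (H₁ →L[ℂ] H₂)) : Prop :=
  ∀ (K₁ K₂ T₁ T₂ : Type)
    [NormedAddCommGroup K₁] [InnerProductSpace ℂ K₁] [CompleteSpace K₁]
    [NormedAddCommGroup K₂] [InnerProductSpace ℂ K₂] [CompleteSpace K₂]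
    [NormedAddCommGroup T₁] [InnerProductSpace ℂ T₁] [CompleteSpace T₁]
    [NormedAddCommGroup T₂] [InnerProductSpace ℂ T₂] [CompleteSpace T₂]
    (t₁ : H₁ → K₁ → T₁) (t₂ : H₂ → K₂ → T₂),
    IsTensorEmbedding t₁ → IsTensorEmbedding t₂ →
    ∀ U : Set (K₁ →L[ℂ] K₂), IsWkClosedSubspace U →
      Fubini t₁ t₂ V U = wTensor t₁ t₂ V U

section Masa

variable {H H₁ H₂ H₃ : Type*}
  [NormedAddCommGroup H] [InnerProductSpace ℂ H] [CompleteSpace H]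
  [NormedAddCommGroup H₁] [InnerProductSpace ℂ H₁] [CompleteSpace H₁]
  [NormedAddCommGroup H₂] [InnerProductSpace ℂ H₂] [CompleteSpace H₂]
  [NormedAddCommGroup H₃] [InnerProductSpace ℂ H₃] [CompleteSpace H₃]

/-- A masa: a maximal abelian selfadjoint subalgebra of `B(H)`. -/
def IsMasa (D : StarSubalgebra ℂ (H →L[ℂ] H)) : Prop :=
  (∀ a ∈ D, ∀ b ∈ D, a * b = b * a) ∧
  ∀ E : StarSubalgebra ℂ (H →L[ℂ] H),
    (∀ a ∈ E, ∀ b ∈ E, a * b = b * a) → D ≤ E → E = D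

/-- A (weak* closed) `D₂,D₁`-masa-bimodule. -/
def IsMasaBimodule (D₁ : StarSubalgebra ℂ (H₁ →L[ℂ] H₁))
    (D₂ : StarSubalgebra ℂ (H₂ →L[ℂ] H₂)) (V : Set (H₁ →L[ℂ] H₂)) : Prop :=
  IsWkClosedSubspace V ∧
  ∀ X ∈ V, ∀ A ∈ D₁, ∀ B ∈ D₂, B ∘L X ∘L A ∈ V

/-- A ternary set of operators: closed under the triple product `T S* R`. -/
def IsTernary (M : Set (H₁ →L[ℂ] H₂)) : Prop :=
  ∀ T ∈ M, ∀ S ∈ M, ∀ R ∈ M, T ∘L (ContinuousLinearMap.adjoint S) ∘L R ∈ M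

/-- An orthogonal projection. -/
def IsProj (p : H →L[ℂ] H) : Prop := p ∘L p = p ∧ IsSelfAdjoint p

/-- A minimal non-zero projection of a masa. -/
def IsMinimalProjOf (D : StarSubalgebra ℂ (H →L[ℂ] H)) (p : H →L[ℂ] H) : Prop :=
  p ∈ D ∧ IsProj p ∧ p ≠ 0 ∧
    ∀ q ∈ D, IsProj q → p ∘L q = q → q = 0 ∨ q = p

/-- A projection in a masa is non-atomic if it dominates no minimal non-zero
projection of the masa. -/
def IsNonAtomicProj (D : StarSubalgebra ℂ (H →L[ℂ] H)) (E : H →L[ℂ] H) : Prop :=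
  ∀ p, IsMinimalProjOf D p → ¬ (E ∘L p = p)

/-- A `D₂,D₁`-masa-bimodule map. -/
def IsMasaBimoduleMap (D₁ : StarSubalgebra ℂ (H₁ →L[ℂ] H₁))
    (D₂ : StarSubalgebra ℂ (H₂ →L[ℂ] H₂))
    (φ : (H₁ →L[ℂ] H₂) → (H₁ →L[ℂ] H₂)) : Prop :=
  ∀ (X : H₁ →L[ℂ] H₂), ∀ A ∈ D₁, ∀ B ∈ D₂,
    φ (B ∘L X ∘L A) = B ∘L (φ X) ∘L A

/-- A Schur idempotent: a weak* continuous completely bounded idempotent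
masa-bimodule map. -/
def IsSchurIdempotent (D₁ : StarSubalgebra ℂ (H₁ →L[ℂ] H₁))
    (D₂ : StarSubalgebra ℂ (H₂ →L[ℂ] H₂))
    (φ : (H₁ →L[ℂ] H₂) → (H₁ →L[ℂ] H₂)) : Prop :=
  IsLinearMap ℂ φ ∧ WkContinuous φ ∧ CompletelyBounded φ ∧ φ ∘ φ = φ ∧
    IsMasaBimoduleMap D₁ D₂ φ

/-- A nest: a totally ordered family of closed subspaces containing the
intersection and the closed linear span of any of its subsets. -/
def IsNest (N : Set (Submodule ℂ H)) : Prop :=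
  (∀ p ∈ N, IsClosed (p : Set H)) ∧ IsChain (· ≤ ·) N ∧
  ∀ S : Set (Submodule ℂ H), S ⊆ N →
    sInf S ∈ N ∧ (sSup S).topologicalClosure ∈ N

/-- The nest algebra of a nest: all operators leaving each subspace invariant. -/
def nestAlg (N : Set (Submodule ℂ H)) : Set (H →L[ℂ] H) :=
  { T | ∀ p ∈ N, ∀ x ∈ p, T x ∈ p }

/-- A (weak* closed) nest algebra bimodule. -/
def IsNestBimodule (V : Set (H₁ →L[ℂ] H₂)) : Prop :=
  IsWkClosedSubspace V ∧
  ∃ (N₁ : Set (Submodule ℂ H₁)) (N₂ : Set (Submodule ℂ H₂)),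
    IsNest N₁ ∧ IsNest N₂ ∧
    ∀ X ∈ V, ∀ A ∈ nestAlg N₁, ∀ B ∈ nestAlg N₂, B ∘L X ∘L A ∈ V

/-- A masa-bimodule of finite width: a finite intersection of masa-bimodules
each of which is a nest algebra bimodule. -/
def HasFiniteWidth (D₁ : StarSubalgebra ℂ (H₁ →L[ℂ] H₁))
    (D₂ : StarSubalgebra ℂ (H₂ →L[ℂ] H₂)) (V : Set (H₁ →L[ℂ] H₂)) : Prop :=
  ∃ (k : ℕ) (Vs : Fin k → Set (H₁ →L[ℂ] H₂)),
    (∀ j, IsMasaBimodule D₁ D₂ (Vs j) ∧ IsNestBimodule (Vs j)) ∧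
    V = ⋂ j, Vs j

end Masa

section Algebras

variable {H H₁ H₂ H₃ K : Type*}
  [NormedAddCommGroup H] [InnerProductSpace ℂ H] [CompleteSpace H]
  [NormedAddCommGroup H₁] [InnerProductSpace ℂ H₁] [CompleteSpace H₁]
  [NormedAddCommGroup H₂] [InnerProductSpace ℂ H₂] [CompleteSpace H₂]
  [NormedAddCommGroup H₃] [InnerProductSpace ℂ H₃] [CompleteSpace H₃]

/-- A weak* closed unital operator algebra in `B(H)`. -/
def IsWkClosedUnitalAlg (A : Set (H →L[ℂ] H)) : Prop :=
  IsWkClosedSubspace A ∧ (1 : H →L[ℂ] H) ∈ A ∧ ∀ a ∈ A, ∀ b ∈ A, a ∘L b ∈ A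

/-- `[X Y]`: the weak* closed linear span of the products `x ∘ y`. -/
def mulSpan (X : Set (H₂ →L[ℂ] H₃)) (Y : Set (H₁ →L[ℂ] H₂)) :
    Set (H₁ →L[ℂ] H₃) :=
  wkClosure ↑(Submodule.span ℂ { T : H₁ →L[ℂ] H₃ | ∃ x ∈ X, ∃ y ∈ Y, T = x ∘L y })

/-- The data witnessing a spatial embedding of `A` into `B`. -/
def SpatialPair (A : Set (H₁ →L[ℂ] H₁)) (B : Set (H₂ →L[ℂ] H₂))
    (X : Set (H₁ →L[ℂ] H₂)) (Y : Set (H₂ →L[ℂ] H₁)) : Prop :=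
  IsWkClosedSubspace X ∧ IsWkClosedSubspace Y ∧
  (∀ x ∈ X, ∀ b ∈ B, ∀ a ∈ A, b ∘L x ∘L a ∈ X) ∧
  (∀ y ∈ Y, ∀ a ∈ A, ∀ b ∈ B, a ∘L y ∘L b ∈ Y) ∧
  mulSpan X Y ⊆ B ∧ mulSpan Y X = A

/-- `A` is spatially embedded in `B`. -/
def SpatiallyEmbedded (A : Set (H₁ →L[ℂ] H₁)) (B : Set (H₂ →L[ℂ] H₂)) : Prop :=
  ∃ X Y, SpatialPair A B X Y

/-- `A` and `B` are spatially Morita equivalent. -/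
def SpatiallyMorita (A : Set (H₁ →L[ℂ] H₁)) (B : Set (H₂ →L[ℂ] H₂)) : Prop :=
  ∃ X Y, SpatialPair A B X Y ∧ mulSpan X Y = B

/-- The strong operator topology on `B(H,K)`. -/
def sot (H K : Type*) [NormedAddCommGroup H] [InnerProductSpace ℂ H]
    [NormedAddCommGroup K] [InnerProductSpace ℂ K] :
    TopologicalSpace (H →L[ℂ] K) :=
  TopologicalSpace.induced (fun T : H →L[ℂ] K => (T : H → K)) Pi.topologicalSpace

/-- A commutative subspace lattice (CSL): a strongly closed lattice of mutually
commuting orthogonal projections containing `0` and `1`. -/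
def IsCSL (L : Set (H →L[ℂ] H)) : Prop :=
  (∀ P ∈ L, IsProj P) ∧
  (∀ P ∈ L, ∀ Q ∈ L, P ∘L Q = Q ∘L P) ∧
  (0 : H →L[ℂ] H) ∈ L ∧ (1 : H →L[ℂ] H) ∈ L ∧
  (∀ P ∈ L, ∀ Q ∈ L, P ∘L Q ∈ L ∧ P + Q - P ∘L Q ∈ L) ∧
  @IsClosed _ (sot H H) L

/-- The CSL algebra `Alg L = {T : (1 - P) T P = 0 for all P ∈ L}`. -/
def cslAlg (L : Set (H →L[ℂ] H)) : Set (H →L[ℂ] H) :=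
  { T | ∀ P ∈ L, (1 - P) ∘L T ∘L P = 0 }

/-- A lattice homomorphism between CSLs (preserving meets and joins). -/
def IsLatticeHom (L₁ : Set (H₁ →L[ℂ] H₁)) (L₂ : Set (H₂ →L[ℂ] H₂))
    (φ : (H₁ →L[ℂ] H₁) → (H₂ →L[ℂ] H₂)) : Prop :=
  MapsTo φ L₁ L₂ ∧
  (∀ P ∈ L₁, ∀ Q ∈ L₁, φ (P ∘L Q) = φ P ∘L φ Q) ∧
  (∀ P ∈ L₁, ∀ Q ∈ L₁, φ (P + Q - P ∘L Q) = φ P + φ Q - φ P ∘L φ Q)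

end Algebras

section MeasurePart

variable {X X₁ X₂ : Type*} [MeasurableSpace X] [MeasurableSpace X₁] [MeasurableSpace X₂]

/-- A subset of a product of measure spaces is marginally null if it is
contained in `(M₁ × X₂) ∪ (X₁ × M₂)` with `μ₁ M₁ = μ₂ M₂ = 0`. -/
def MargNull (μ₁ : Measure X₁) (μ₂ : Measure X₂) (E : Set (X₁ × X₂)) : Prop :=
  ∃ (M₁ : Set X₁) (M₂ : Set X₂), MeasurableSet M₁ ∧ MeasurableSet M₂ ∧
    μ₁ M₁ = 0 ∧ μ₂ M₂ = 0 ∧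
    E ⊆ (M₁ ×ˢ (univ : Set X₂)) ∪ ((univ : Set X₁) ×ˢ M₂)

/-- Marginal equivalence: the symmetric difference is marginally null. -/
def MargEquiv (μ₁ : Measure X₁) (μ₂ : Measure X₂) (E F : Set (X₁ × X₂)) : Prop :=
  MargNull μ₁ μ₂ ((E \ F) ∪ (F \ E))

/-- ω-open sets: marginally equivalent to a countable union of measurable
rectangles. -/
def OmegaOpen (μ₁ : Measure X₁) (μ₂ : Measure X₂) (E : Set (X₁ × X₂)) : Prop :=
  ∃ (α : ℕ → Set X₁) (β : ℕ → Set X₂),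
    (∀ n, MeasurableSet (α n)) ∧ (∀ n, MeasurableSet (β n)) ∧
    MargEquiv μ₁ μ₂ E (⋃ n, (α n) ×ˢ (β n))

/-- ω-closed sets: complements of ω-open sets. -/
def OmegaClosed (μ₁ : Measure X₁) (μ₂ : Measure X₂) (E : Set (X₁ × X₂)) : Prop :=
  OmegaOpen μ₁ μ₂ Eᶜ

/-- `A` is a multiplication operator on `L²(X,μ)`: `A f = φ · f` for some
essentially bounded function `φ`.  The collection `{A | IsMultOp μ A}` is the
multiplication masa of `L^∞(X,μ)`. -/
def IsMultOp (μ : Measure X) (A : Lp ℂ 2 μ →L[ℂ] Lp ℂ 2 μ) : Prop :=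
  ∃ φ : X → ℂ, AEStronglyMeasurable φ μ ∧ (∃ C, ∀ᵐ x ∂μ, ‖φ x‖ ≤ C) ∧
    ∀ f : Lp ℂ 2 μ, ⇑(A f) =ᵐ[μ] fun x => φ x * f x

/-- A (weak* closed) masa-bimodule over the multiplication masas. -/
def IsMultBimodule (μ₁ : Measure X₁) (μ₂ : Measure X₂)
    (V : Set (Lp ℂ 2 μ₁ →L[ℂ] Lp ℂ 2 μ₂)) : Prop :=
  IsWkClosedSubspace V ∧
  ∀ X ∈ V, ∀ (A : Lp ℂ 2 μ₁ →L[ℂ] Lp ℂ 2 μ₁) (B : Lp ℂ 2 μ₂ →L[ℂ] Lp ℂ 2 μ₂),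
    IsMultOp μ₁ A → IsMultOp μ₂ B → B ∘L X ∘L A ∈ V

/-- `T` is supported on `κ`: `M_{χ_β} T M_{χ_α} = 0` (equivalently,
`⟪T f, g⟫ = 0` whenever `f` vanishes off `α` and `g` vanishes off `β`)
whenever the rectangle `α × β` intersects `κ` marginally nullly. -/
def SupportedOn (μ₁ : Measure X₁) (μ₂ : Measure X₂) (κ : Set (X₁ × X₂))
    (T : Lp ℂ 2 μ₁ →L[ℂ] Lp ℂ 2 μ₂) : Prop :=
  ∀ (α : Set X₁) (β : Set X₂), MeasurableSet α → MeasurableSet β →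
    MargNull μ₁ μ₂ ((α ×ˢ β) ∩ κ) →
    ∀ (f : Lp ℂ 2 μ₁) (g : Lp ℂ 2 μ₂),
      (∀ᵐ x ∂μ₁, x ∉ α → f x = 0) → (∀ᵐ y ∂μ₂, y ∉ β → g y = 0) →
      ⟪T f, g⟫ = (0 : ℂ)

/-- `M_max κ`: the space of all operators supported on `κ` — the largest
masa-bimodule with support `κ`. -/
def Mmax (μ₁ : Measure X₁) (μ₂ : Measure X₂) (κ : Set (X₁ × X₂)) :
    Set (Lp ℂ 2 μ₁ →L[ℂ] Lp ℂ 2 μ₂) :=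
  { T | SupportedOn μ₁ μ₂ κ T }

/-- `U` has support `κ`: `κ` is ω-closed and `Ref U = M_max κ`. -/
def HasSupport (μ₁ : Measure X₁) (μ₂ : Measure X₂)
    (U : Set (Lp ℂ 2 μ₁ →L[ℂ] Lp ℂ 2 μ₂)) (κ : Set (X₁ × X₂)) : Prop :=
  OmegaClosed μ₁ μ₂ κ ∧ RefHull U = Mmax μ₁ μ₂ κ

/-- `M_min κ`: the smallest weak* closed masa-bimodule with support `κ`,
realized as the intersection of all weak* closed masa-bimodules with support `κ`. -/
def Mmin (μ₁ : Measure X₁) (μ₂ : Measure X₂) (κ : Set (X₁ × X₂)) :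
    Set (Lp ℂ 2 μ₁ →L[ℂ] Lp ℂ 2 μ₂) :=
  ⋂₀ { U | IsMultBimodule μ₁ μ₂ U ∧ HasSupport μ₁ μ₂ U κ }

/-- `κ` is operator synthetic if it is ω-closed and `M_min κ = M_max κ`. -/
def OperatorSynthetic (μ₁ : Measure X₁) (μ₂ : Measure X₂)
    (κ : Set (X₁ × X₂)) : Prop :=
  OmegaClosed μ₁ μ₂ κ ∧ Mmin μ₁ μ₂ κ = Mmax μ₁ μ₂ κ

/-- A masa-bimodule of finite width over the multiplication masas. -/
def MultFiniteWidth (μ₁ : Measure X₁) (μ₂ : Measure X₂)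
    (V : Set (Lp ℂ 2 μ₁ →L[ℂ] Lp ℂ 2 μ₂)) : Prop :=
  ∃ (k : ℕ) (Vs : Fin k → Set (Lp ℂ 2 μ₁ →L[ℂ] Lp ℂ 2 μ₂)),
    (∀ j, IsMultBimodule μ₁ μ₂ (Vs j) ∧ IsNestBimodule (Vs j)) ∧
    V = ⋂ j, Vs j

/-- A set of finite width: the support of a masa-bimodule of finite width. -/
def FiniteWidthSet (μ₁ : Measure X₁) (μ₂ : Measure X₂)
    (κ : Set (X₁ × X₂)) : Prop :=
  ∃ V, MultFiniteWidth μ₁ μ₂ V ∧ HasSupport μ₁ μ₂ V κ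

end MeasurePart

/-- The flip `ρ : (X₁ × X₂) × (Y₁ × Y₂) → (X₁ × Y₁) × (X₂ × Y₂)`. -/
def flipProd {X₁ X₂ Y₁ Y₂ : Type*} :
    (X₁ × X₂) × (Y₁ × Y₂) → (X₁ × Y₁) × (X₂ × Y₂) :=
  fun q => ((q.1.1, q.2.1), (q.1.2, q.2.2))

end OpSynth



open scoped ComplexInnerProductSpace Pointwise
open Set MeasureTheory OpSynth

namespace OpSynth

section P1
variable {H K : Type*}
  [NormedAddCommGroup H] [InnerProductSpace ℂ H]
  [NormedAddCommGroup K] [InnerProductSpace ℂ K]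

/-- square summable families -/
def SqS {ι : Type*} (ξ : ι → H) : Prop := Summable fun n => ‖ξ n‖ ^ 2

lemma SqS.norm_pair {ι : Type*} {ξ : ι → H} {η : ι → K} (hξ : SqS ξ) (hη : SqS η) :
    Summable fun n => ‖η n‖ * ‖ξ n‖ := by
  refine Summable.of_nonneg_of_le (fun n => by positivity) (fun n => ?_) (Summable.add hη hξ)
  nlinarith [sq_nonneg (‖η n‖ - ‖ξ n‖), sq_nonneg (‖η n‖ + ‖ξ n‖)]

lemma SqS.pair {ι : Type*} {ξ : ι → H} {η : ι → K} (hξ : SqS ξ) (hη : SqS η) (T : H →L[ℂ] K) :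
    Summable fun n => ⟪η n, T (ξ n)⟫ := by
  refine Summable.of_norm_bounded ((hξ.norm_pair hη).mul_left ‖T‖) (fun n => ?_)
  calc ‖⟪η n, T (ξ n)⟫‖ ≤ ‖η n‖ * ‖T (ξ n)‖ := norm_inner_le_norm _ _
    _ ≤ ‖η n‖ * (‖T‖ * ‖ξ n‖) := by gcongr; exact T.le_opNorm _
    _ = _ := by ring

lemma SqS.extend {ι κ : Type*} {ξ : ι → H} (hξ : SqS ξ) {e : ι → κ} (he : Function.Injective e) :
    SqS (Function.extend e ξ 0) := by
  unfold SqS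
  have : (fun n => ‖Function.extend e ξ 0 n‖ ^ 2) = Function.extend e (fun n => ‖ξ n‖ ^ 2) 0 := by
    funext n
    by_cases h : ∃ a, e a = n
    · obtain ⟨a, rfl⟩ := h
      simp [he.extend_apply]
    · simp [Function.extend_apply' _ _ _ h]
  rw [this]
  exact (summable_extend_zero he).2 hξ

lemma extend_pair {ι κ A B C : Type*} [AddCommMonoid C] [Zero A] [Zero B] {ξ : ι → A} {η : ι → B}
    {e : ι → κ} (he : Function.Injective e) (F : A → B → C) (hF : F 0 0 = 0) :
    (fun n => F (Function.extend e ξ 0 n) (Function.extend e η 0 n)) =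
      Function.extend e (fun n => F (ξ n) (η n)) 0 := by
  funext n
  by_cases h : ∃ a, e a = n
  · obtain ⟨a, rfl⟩ := h
    simp [he.extend_apply]
  · simp [Function.extend_apply' _ _ _ h, hF]

lemma tsum_extend_pair {ι κ : Type*} {ξ : ι → H} {η : ι → K}
    {e : ι → κ} (he : Function.Injective e) (T : H →L[ℂ] K) :
    ∑' n, ⟪Function.extend e η 0 n, T (Function.extend e ξ 0 n)⟫ = ∑' n, ⟪η n, T (ξ n)⟫ := by
  rw [extend_pair he (fun a b => ⟪b, T a⟫) (by simp)]
  exact tsum_extend_zero he _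

/-- the functional of a pair of square summable families -/
def pairF {ι : Type*} (ξ : ι → H) (η : ι → K) (hξ : SqS ξ) (hη : SqS η) :
    (H →L[ℂ] K) →ₗ[ℂ] ℂ where
  toFun T := ∑' n, ⟪η n, T (ξ n)⟫
  map_add' S T := by
    rw [← (hξ.pair hη S).tsum_add (hξ.pair hη T)]
    simp [inner_add_right]
  map_smul' c T := by
    simp [inner_smul_right, tsum_mul_left]

lemma continuous_pair {ξ : ℕ → H} {η : ℕ → K} (hξ : SqS ξ) (hη : SqS η) :
    @Continuous _ _ (sigmaWeak H K) _ (fun T : H →L[ℂ] K => ∑' n, ⟪η n, T (ξ n)⟫) := by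
  unfold sigmaWeak
  exact continuous_iInf_dom (i := ξ) <| continuous_iInf_dom (i := η) <|
    continuous_iInf_dom (i := hξ) <| continuous_iInf_dom (i := hη) continuous_induced_dom

lemma wkClosed_pair {ξ : ℕ → H} {η : ℕ → K} (hξ : SqS ξ) (hη : SqS η) :
    WkClosed {T : H →L[ℂ] K | ∑' n, ⟪η n, T (ξ n)⟫ = 0} := by
  letI := sigmaWeak H K
  exact isClosed_eq (continuous_pair hξ hη) continuous_const

lemma sqS_pi_single (x : H) : SqS (Pi.single (M := fun _ : ℕ => H) 0 x) := by
  refine summable_of_ne_finset_zero (s := {0}) (fun n hn => ?_)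
  have : n ≠ 0 := by simpa using hn
  simp [Pi.single_apply, this]

lemma tsum_pi_single (x : H) (y : K) (T : H →L[ℂ] K) :
    ∑' n, ⟪Pi.single (M := fun _ : ℕ => K) 0 y n, T (Pi.single (M := fun _ : ℕ => H) 0 x n)⟫
      = ⟪y, T x⟫ := by
  rw [tsum_eq_single 0]
  · simp
  · intro n hn; simp [Pi.single_apply, hn]

lemma wkClosed_inner (x : H) (y : K) : WkClosed {T : H →L[ℂ] K | ⟪y, T x⟫ = 0} := by
  have := wkClosed_pair (sqS_pi_single x) (sqS_pi_single y)
  simpa only [tsum_pi_single] using this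

/-- merge two sequences -/
def mergeS {A : Type*} (f g : ℕ → A) : ℕ → A := Sum.elim f g ∘ Equiv.natSumNatEquivNat.symm

lemma hasSum_merge {A B C : Type*} [AddCommMonoid C] [TopologicalSpace C] [ContinuousAdd C]
    {f f' : ℕ → A} {g g' : ℕ → B} (F : A → B → C) {c c' : C}
    (h : HasSum (fun n => F (f n) (g n)) c) (h' : HasSum (fun n => F (f' n) (g' n)) c') :
    HasSum (fun n => F (mergeS f f' n) (mergeS g g' n)) (c + c') := by
  have : HasSum (fun s : ℕ ⊕ ℕ => F (Sum.elim f f' s) (Sum.elim g g' s)) (c + c') :=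
    HasSum.sum (by simpa [Function.comp_def] using h) (by simpa [Function.comp_def] using h')
  exact (Equiv.natSumNatEquivNat.symm.hasSum_iff (f := fun s : ℕ ⊕ ℕ => F (Sum.elim f f' s) (Sum.elim g g' s))).2 this

lemma hasSum_merge_sq {f f' : ℕ → H} {c c' : ℝ}
    (h : HasSum (fun n => ‖f n‖ ^ 2) c) (h' : HasSum (fun n => ‖f' n‖ ^ 2) c') :
    HasSum (fun n => ‖mergeS f f' n‖ ^ 2) (c + c') :=
  hasSum_merge (g := f) (g' := f') (fun a _ => ‖a‖ ^ 2) h h'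

lemma SqS.merge {f f' : ℕ → H} (h : SqS f) (h' : SqS f') : SqS (mergeS f f') :=
  (hasSum_merge_sq h.hasSum h'.hasSum).summable

/-- normal functionals form a submodule -/
def normalF (H K : Type*)
  [NormedAddCommGroup H] [InnerProductSpace ℂ H]
  [NormedAddCommGroup K] [InnerProductSpace ℂ K] : Submodule ℂ ((H →L[ℂ] K) →ₗ[ℂ] ℂ) where
  carrier := {φ | ∃ (ξ : ℕ → H) (η : ℕ → K), SqS ξ ∧ SqS η ∧ ∀ T, φ T = ∑' n, ⟪η n, T (ξ n)⟫}
  zero_mem' := ⟨0, 0, by simp [SqS, summable_zero], by simp [SqS, summable_zero], by simp⟩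
  add_mem' := by
    rintro φ ψ ⟨ξ, η, h1, h2, h3⟩ ⟨ξ', η', h1', h2', h3'⟩
    refine ⟨mergeS ξ ξ', mergeS η η', h1.merge h1', h2.merge h2', fun T => ?_⟩
    rw [LinearMap.add_apply, h3, h3']
    exact (hasSum_merge (fun a b => ⟪b, T a⟫) (h1.pair h2 T).hasSum
      (h1'.pair h2' T).hasSum).tsum_eq.symm
  smul_mem' := by
    rintro c φ ⟨ξ, η, h1, h2, h3⟩
    refine ⟨fun n => c • ξ n, η, ?_, h2, fun T => ?_⟩
    · have := h1.mul_left (‖c‖ ^ 2)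
      simpa [SqS, norm_smul, mul_pow] using this
    · simp [h3, inner_smul_right, tsum_mul_left]

lemma sigmaWeak_eq : sigmaWeak H K = ⨅ i : normalF H K,
    TopologicalSpace.induced (i : (H →L[ℂ] K) →ₗ[ℂ] ℂ) inferInstance := by
  unfold sigmaWeak
  apply le_antisymm
  · refine le_iInf fun i => ?_
    obtain ⟨φ, ξ, η, h1, h2, h3⟩ := i
    refine iInf_le_of_le ξ <| iInf_le_of_le η <| iInf_le_of_le h1 <| iInf_le_of_le h2 ?_
    have : (φ : (H →L[ℂ] K) → ℂ) = fun T => ∑' n, ⟪η n, T (ξ n)⟫ := funext h3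
    simp only [this]; exact le_rfl
  · refine le_iInf fun ξ => le_iInf fun η => le_iInf fun h1 => le_iInf fun h2 => ?_
    exact iInf_le_of_le ⟨pairF ξ η h1 h2, ξ, η, h1, h2, fun T => rfl⟩ le_rfl

lemma exists_sep {U : Set (H →L[ℂ] K)} (hU : IsWkClosedSubspace U) {T : H →L[ℂ] K} (hT : T ∉ U) :
    ∃ (ξ : ℕ → H) (η : ℕ → K), SqS ξ ∧ SqS η ∧ (∀ S ∈ U, ∑' n, ⟪η n, S (ξ n)⟫ = 0) ∧
      ∑' n, ⟪η n, T (ξ n)⟫ ≠ 0 := by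
  obtain ⟨⟨M, rfl⟩, hc⟩ := hU
  let Φ : (H →L[ℂ] K) →ₗ[ℂ] (normalF H K → ℂ) := LinearMap.pi fun i => (i : (H →L[ℂ] K) →ₗ[ℂ] ℂ)
  have htop : sigmaWeak H K = TopologicalSpace.induced Φ inferInstance := by
    rw [sigmaWeak_eq]
    exact (induced_to_pi (fun x => Φ x)).symm
  unfold WkClosed at hc
  rw [htop] at hc
  have hnot : Φ T ∉ closure (Φ '' (M : Set (H →L[ℂ] K))) := by
    intro h
    have h2 := (@closure_induced _ _ _ Φ T (M : Set (H →L[ℂ] K))).2 h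
    rw [@IsClosed.closure_eq _ (TopologicalSpace.induced Φ inferInstance) _ hc] at h2
    exact hT h2
  let N : Submodule ℂ (normalF H K → ℂ) := (M.map Φ).topologicalClosure
  have hN : (N : Set (normalF H K → ℂ)) = closure (Φ '' (M : Set (H →L[ℂ] K))) := by
    simp [N, Submodule.topologicalClosure_coe]
  obtain ⟨f, u, hf1, hf2⟩ := RCLike.geometric_hahn_banach_closed_point (𝕜 := ℂ)
    (s := (N : Set (normalF H K → ℂ))) (x := Φ T) ((N.restrictScalars ℝ).convex)
    (Submodule.isClosed_topologicalClosure _) (by rw [hN]; exact hnot)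
  have hf0 : ∀ a ∈ N, f a = 0 := by
    intro a ha
    by_contra hne
    have := hf1 ((((u + 1 : ℝ) : ℂ) / f a) • a) (N.smul_mem _ ha)
    rw [map_smul, smul_eq_mul, div_mul_cancel₀ _ hne] at this
    have h3 : RCLike.re ((u + 1 : ℝ) : ℂ) = u + 1 := by simp
    rw [h3] at this
    linarith
  have hu : 0 < u := by
    have := hf1 0 N.zero_mem
    simpa using this
  let φ : (H →L[ℂ] K) →ₗ[ℂ] ℂ := f.toLinearMap ∘ₗ Φ
  have hφ : φ ∈ normalF H K := by
    have : φ ∈ Submodule.span ℂ (Set.range fun i : normalF H K => (i : (H →L[ℂ] K) →ₗ[ℂ] ℂ)) := by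
      rw [LinearMap.mem_span_iff_continuous]
      have := sigmaWeak_eq (H := H) (K := K)
      rw [← this, htop]
      exact @Continuous.comp _ _ _ (TopologicalSpace.induced Φ inferInstance) _ _ Φ f f.continuous
        (@continuous_induced_dom _ _ Φ _)
    simpa using this
  obtain ⟨ξ, η, h1, h2, h3⟩ := hφ
  refine ⟨ξ, η, h1, h2, fun S hS => ?_, ?_⟩
  · rw [← h3]
    exact hf0 _ ((M.map Φ).le_topologicalClosure ⟨S, hS, rfl⟩)
  · rw [← h3]
    intro h0
    have : f (Φ T) = 0 := h0
    rw [this] at hf2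
    simp at hf2
    linarith

end P1
end OpSynth

namespace OpSynth

section P2
open Filter
open scoped ENNReal ComplexConjugate
variable {X Y : Type*} [MeasurableSpace X] [MeasurableSpace Y] {μ : Measure X} {ν : Measure Y}

lemma margNull_iff {E : Set (X × Y)} :
    MargNull μ ν E ↔ ∀ᶠ p in (ae μ ×ˢ ae ν), p ∉ E := by
  constructor
  · rintro ⟨M₁, M₂, h1, h2, h3, h4, h5⟩
    have a1 : ∀ᵐ x ∂μ, x ∉ M₁ := measure_eq_zero_iff_ae_notMem.1 h3
    have a2 : ∀ᵐ x ∂ν, x ∉ M₂ := measure_eq_zero_iff_ae_notMem.1 h4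
    filter_upwards [a1.prod_inl _, a2.prod_inr _] with p hp1 hp2 hp
    rcases h5 hp with h | h
    · exact hp1 h.1
    · exact hp2 h.2
  · intro h
    obtain ⟨P, hP, Q, hQ, h⟩ := eventually_prod_iff.1 h
    have hP' : μ {x | ¬ P x} = 0 := hP
    have hQ' : ν {x | ¬ Q x} = 0 := hQ
    refine ⟨toMeasurable μ {x | ¬ P x}, toMeasurable ν {x | ¬ Q x}, measurableSet_toMeasurable _ _,
      measurableSet_toMeasurable _ _, by rw [measure_toMeasurable]; exact hP',
      by rw [measure_toMeasurable]; exact hQ', ?_⟩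
    intro p hp
    by_cases h1 : P p.1
    · by_cases h2 : Q p.2
      · exact absurd hp (h h1 h2)
      · exact Or.inr ⟨trivial, subset_toMeasurable _ _ h2⟩
    · exact Or.inl ⟨subset_toMeasurable _ _ h1, trivial⟩

lemma lp_enorm_sq (f : Lp ℂ 2 μ) : ‖f‖ₑ ^ 2 = ∫⁻ x, ‖f x‖ₑ ^ 2 ∂μ := by
  rw [Lp.enorm_def, eLpNorm_eq_lintegral_rpow_enorm_toReal (by norm_num) (by norm_num)]
  simp only [ENNReal.toReal_ofNat, ENNReal.rpow_ofNat, one_div]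
  rw [← ENNReal.rpow_natCast, ← ENNReal.rpow_mul]
  norm_num

lemma enorm_sq_eq_ofReal {E : Type*} [NormedAddCommGroup E] (v : E) :
    ‖v‖ₑ ^ 2 = ENNReal.ofReal (‖v‖ ^ 2) := by
  rw [← ofReal_norm, ENNReal.ofReal_pow (norm_nonneg _)]

lemma sqS_iff_enorm {ι E : Type*} [NormedAddCommGroup E] (v : ι → E) :
    SqS v ↔ ∑' n, ‖v n‖ₑ ^ 2 ≠ ∞ := by
  unfold SqS
  constructor
  · intro h
    have e : (fun n => ‖v n‖ₑ ^ 2) = fun n => ENNReal.ofReal (‖v n‖ ^ 2) :=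
      funext fun n => enorm_sq_eq_ofReal _
    rw [e]
    exact Summable.tsum_ofReal_ne_top h
  · intro h
    have := ENNReal.summable_toReal h
    have e : (fun n => (‖v n‖ₑ ^ 2).toReal) = fun n => ‖v n‖ ^ 2 := by
      funext n
      rw [enorm_sq_eq_ofReal, ENNReal.toReal_ofReal (sq_nonneg _)]
    rwa [e] at this

lemma ae_sqS_fun {ι E : Type*} [Countable ι] [NormedAddCommGroup E] {f : ι → X → E}
    (hf : ∀ n, AEMeasurable (fun x => ‖f n x‖ₑ) μ)
    (h : ∑' n, ∫⁻ x, ‖f n x‖ₑ ^ 2 ∂μ ≠ ∞) : ∀ᵐ x ∂μ, SqS (fun n => f n x) := by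
  rw [← lintegral_tsum (fun n => (hf n).pow_const 2)] at h
  filter_upwards [ae_lt_top' (AEMeasurable.ennreal_tsum fun n => (hf n).pow_const 2) h] with x hx
  exact (sqS_iff_enorm _).2 hx.ne

lemma ae_sqS {ι : Type*} [Countable ι] {ξ : ι → Lp ℂ 2 μ} (h : SqS ξ) :
    ∀ᵐ x ∂μ, SqS (fun n => ξ n x) := by
  refine ae_sqS_fun (fun n => (Lp.aestronglyMeasurable (ξ n)).enorm) ?_
  have := (sqS_iff_enorm ξ).1 h
  simpa only [lp_enorm_sq] using this

lemma sqS_mul {ι : Type*} {a b : ι → ℂ} (ha : SqS a) (hb : SqS b) :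
    Summable fun n => a n * conj (b n) := by
  refine Summable.of_norm ?_
  simpa [mul_comm] using ha.norm_pair hb

/-- `u` is represented on `L` by the families. -/
def KerRep {ι : Type*} (μ : Measure X) (ν : Measure Y) (L : Set (X × Y)) (ξ : ι → Lp ℂ 2 μ)
    (η : ι → Lp ℂ 2 ν) (u : X × Y → ℂ) : Prop :=
  ∀ᶠ p in (ae μ ×ˢ ae ν), p ∈ L → HasSum (fun n => ξ n p.1 * conj (η n p.2)) (u p)

def Rep (μ : Measure X) (ν : Measure Y) (L : Set (X × Y)) (u : X × Y → ℂ) (C : ℝ) : Prop :=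
  ∃ (ξ : ℕ → Lp ℂ 2 μ) (η : ℕ → Lp ℂ 2 ν) (a b : ℝ), HasSum (fun n => ‖ξ n‖ ^ 2) a ∧
    HasSum (fun n => ‖η n‖ ^ 2) b ∧ a ≤ C ∧ b ≤ C ∧ KerRep μ ν L ξ η u

variable {L : Set (X × Y)}

lemma Rep.nonneg {u : X × Y → ℂ} {C : ℝ} (h : Rep μ ν L u C) : 0 ≤ C := by
  obtain ⟨ξ, η, a, b, h1, h2, h3, h4, h5⟩ := h
  exact (h1.nonneg fun n => by positivity).trans h3

lemma Rep.add {u v : X × Y → ℂ} {C D : ℝ} (h : Rep μ ν L u C) (h' : Rep μ ν L v D) :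
    Rep μ ν L (u + v) (C + D) := by
  obtain ⟨ξ, η, a, b, h1, h2, h3, h4, h5⟩ := h
  obtain ⟨ξ', η', a', b', h1', h2', h3', h4', h5'⟩ := h'
  refine ⟨mergeS ξ ξ', mergeS η η', _, _, hasSum_merge_sq h1 h1', hasSum_merge_sq h2 h2',
    by linarith, by linarith, ?_⟩
  filter_upwards [h5, h5'] with p hp hp' hL
  exact hasSum_merge (fun (a : Lp ℂ 2 μ) (b : Lp ℂ 2 ν) => a p.1 * conj (b p.2)) (hp hL) (hp' hL)

lemma Rep.mono {u : X × Y → ℂ} {C D : ℝ} (h : Rep μ ν L u C) (hCD : C ≤ D) : Rep μ ν L u D := by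
  obtain ⟨ξ, η, a, b, h1, h2, h3, h4, h5⟩ := h
  exact ⟨ξ, η, a, b, h1, h2, h3.trans hCD, h4.trans hCD, h5⟩

lemma Rep.of_ae_zero {u : X × Y → ℂ} (h : ∀ᶠ p in (ae μ ×ˢ ae ν), p ∈ L → u p = 0) :
    Rep μ ν L u 0 := by
  refine ⟨fun _ => 0, fun _ => 0, 0, 0, by simp, by simp, le_rfl, le_rfl, ?_⟩
  have h1 : ∀ᵐ x ∂μ, (0 : Lp ℂ 2 μ) x = 0 := Lp.coeFn_zero _ _ _
  filter_upwards [h, h1.prod_inl _] with p hp h1 hL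
  rw [hp hL]
  have e : (fun n : ℕ => (0 : Lp ℂ 2 μ) p.1 * conj ((0 : Lp ℂ 2 ν) p.2)) = fun _ => 0 := by
    funext n; rw [h1, zero_mul]
  rw [e]; exact hasSum_zero

lemma Rep.smul {u : X × Y → ℂ} {C : ℝ} (h : Rep μ ν L u C) (c : ℂ) :
    Rep μ ν L (c • u) (‖c‖ * C) := by
  by_cases hc : c = 0
  · subst hc
    simpa using Rep.of_ae_zero (L := L) (μ := μ) (ν := ν) (u := 0) (by simp)
  obtain ⟨ξ, η, a, b, h1, h2, h3, h4, h5⟩ := h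
  have hcn : 0 < ‖c‖ := norm_pos_iff.2 hc
  set s : ℝ := Real.sqrt ‖c‖
  have hs : s ^ 2 = ‖c‖ := Real.sq_sqrt hcn.le
  have hs0 : 0 < s := Real.sqrt_pos.2 hcn
  refine ⟨fun n => (c / s) • ξ n, fun n => (s : ℂ) • η n, ‖c‖ * a, ‖c‖ * b, ?_, ?_, by gcongr,
    by gcongr, ?_⟩
  · have e : (fun n => ‖(c / (s : ℂ)) • ξ n‖ ^ 2) = fun n => ‖c‖ * ‖ξ n‖ ^ 2 := by
     funext n
     rw [norm_smul, mul_pow, norm_div, div_pow]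
     simp only [Complex.norm_real, Real.norm_eq_abs, sq_abs, hs]
     field_simp
    rw [e]; exact h1.mul_left _
  · have e : (fun n => ‖(s : ℂ) • η n‖ ^ 2) = fun n => ‖c‖ * ‖η n‖ ^ 2 := by
     funext n
     rw [norm_smul, mul_pow]
     simp only [Complex.norm_real, Real.norm_eq_abs, sq_abs, hs]
    rw [e]; exact h2.mul_left _
  · have e1 : ∀ᵐ x ∂μ, ∀ n, ((c / s) • ξ n : Lp ℂ 2 μ) x = (c / s) * ξ n x := by
      rw [ae_all_iff]; intro n
      filter_upwards [Lp.coeFn_smul (c / (s : ℂ)) (ξ n)] with x hx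
      simpa using hx
    have e2 : ∀ᵐ x ∂ν, ∀ n, ((s : ℂ) • η n : Lp ℂ 2 ν) x = s * η n x := by
      rw [ae_all_iff]; intro n
      filter_upwards [Lp.coeFn_smul (s : ℂ) (η n)] with x hx
      simpa using hx
    filter_upwards [h5, e1.prod_inl _, e2.prod_inr _] with p hp e1 e2 hL
    have e : (fun n => ((c / s) • ξ n : Lp ℂ 2 μ) p.1 * conj (((s : ℂ) • η n : Lp ℂ 2 ν) p.2)) =
        fun n => c * (ξ n p.1 * conj (η n p.2)) := by
      funext n
      rw [e1, e2, map_mul, Complex.conj_ofReal]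
      have : (s : ℂ) ≠ 0 := by exact_mod_cast hs0.ne'
      field_simp
    rw [e]; exact (hp hL).mul_left c

/-- elementary kernel -/
def elemK (f : Lp ℂ 2 μ) (g : Lp ℂ 2 ν) : X × Y → ℂ := fun p => f p.1 * conj (g p.2)

lemma Rep.single_aux (f : Lp ℂ 2 μ) (g : Lp ℂ 2 ν) {C : ℝ} (hf : ‖f‖ ^ 2 ≤ C) (hg : ‖g‖ ^ 2 ≤ C) :
    Rep μ ν L (elemK f g) C := by
  refine ⟨Pi.single 0 f, Pi.single 0 g, ‖f‖ ^ 2, ‖g‖ ^ 2, ?_, ?_, hf, hg, ?_⟩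
  · convert hasSum_single (f := fun n => ‖(Pi.single 0 f : ℕ → Lp ℂ 2 μ) n‖ ^ 2) 0 ?_ using 1
    · simp
    · intro n hn; simp [hn]
  · convert hasSum_single (f := fun n => ‖(Pi.single 0 g : ℕ → Lp ℂ 2 ν) n‖ ^ 2) 0 ?_ using 1
    · simp
    · intro n hn; simp [hn]
  · have h1 : ∀ᵐ x ∂μ, (0 : Lp ℂ 2 μ) x = 0 := Lp.coeFn_zero _ _ _
    filter_upwards [h1.prod_inl _] with p h1 hL
    convert hasSum_single (f := fun n => (Pi.single 0 f : ℕ → Lp ℂ 2 μ) n p.1 *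
      conj ((Pi.single 0 g : ℕ → Lp ℂ 2 ν) n p.2)) 0 ?_ using 1
    · rw [Pi.single_eq_same, Pi.single_eq_same]; rfl
    · intro n hn; rw [Pi.single_eq_of_ne hn, h1, zero_mul]

lemma elemK_add_left (f f' : Lp ℂ 2 μ) (g : Lp ℂ 2 ν) :
    ∀ᶠ p in (ae μ ×ˢ ae ν), elemK (f + f') g p = elemK f g p + elemK f' g p := by
  have h := Lp.coeFn_add f f'
  filter_upwards [Eventually.prod_inl h _] with p hp
  simp only [elemK]; rw [hp, Pi.add_apply, add_mul]

lemma elemK_smul_left (c : ℂ) (f : Lp ℂ 2 μ) (g : Lp ℂ 2 ν) :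
    ∀ᶠ p in (ae μ ×ˢ ae ν), elemK (c • f) g p = c * elemK f g p := by
  have h := Lp.coeFn_smul c f
  filter_upwards [Eventually.prod_inl h _] with p hp
  simp only [elemK]; rw [hp, Pi.smul_apply, smul_eq_mul, mul_assoc]

lemma elemK_add_right (f : Lp ℂ 2 μ) (g g' : Lp ℂ 2 ν) :
    ∀ᶠ p in (ae μ ×ˢ ae ν), elemK f (g + g') p = elemK f g p + elemK f g' p := by
  have h := Lp.coeFn_add g g'
  filter_upwards [Eventually.prod_inr h _] with p hp
  simp only [elemK]; rw [hp, Pi.add_apply, map_add, mul_add]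

lemma elemK_smul_right (c : ℂ) (f : Lp ℂ 2 μ) (g : Lp ℂ 2 ν) :
    ∀ᶠ p in (ae μ ×ˢ ae ν), elemK f (c • g) p = conj c * elemK f g p := by
  have h := Lp.coeFn_smul c g
  filter_upwards [Eventually.prod_inr h _] with p hp
  simp only [elemK]; rw [hp, Pi.smul_apply, smul_eq_mul, map_mul]; ring

lemma Rep.single (f : Lp ℂ 2 μ) (g : Lp ℂ 2 ν) : Rep μ ν L (elemK f g) (‖f‖ * ‖g‖) := by
  by_cases hf : f = 0
  · subst hf
    have h1 : ∀ᵐ x ∂μ, (0 : Lp ℂ 2 μ) x = 0 := Lp.coeFn_zero _ _ _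
    simp only [norm_zero, zero_mul]
    refine Rep.of_ae_zero ?_
    filter_upwards [h1.prod_inl _] with p h1 hL
    simp only [elemK]; rw [h1, zero_mul]
  by_cases hg : g = 0
  · subst hg
    have h1 : ∀ᵐ x ∂ν, (0 : Lp ℂ 2 ν) x = 0 := Lp.coeFn_zero _ _ _
    simp only [norm_zero, mul_zero]
    refine Rep.of_ae_zero ?_
    filter_upwards [h1.prod_inr _] with p h1 hL
    simp only [elemK]; rw [h1, map_zero, mul_zero]
  have hf' : 0 < ‖f‖ := norm_pos_iff.2 hf
  have hg' : 0 < ‖g‖ := norm_pos_iff.2 hg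
  have h1 := Rep.single_aux (L := L) (((‖f‖⁻¹ : ℝ) : ℂ) • f) (((‖g‖⁻¹ : ℝ) : ℂ) • g) (C := 1)
    (by rw [norm_smul, Complex.norm_real, norm_inv, norm_norm, inv_mul_cancel₀ hf'.ne']; norm_num)
    (by rw [norm_smul, Complex.norm_real, norm_inv, norm_norm, inv_mul_cancel₀ hg'.ne']; norm_num)
  have h2 := h1.smul ((‖f‖ * ‖g‖ : ℝ) : ℂ)
  have h3 : Rep μ ν L (elemK f g - ((‖f‖ * ‖g‖ : ℝ) : ℂ) •
      elemK (((‖f‖⁻¹ : ℝ) : ℂ) • f) (((‖g‖⁻¹ : ℝ) : ℂ) • g)) 0 := by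
    refine Rep.of_ae_zero ?_
    filter_upwards [elemK_smul_left ((‖f‖⁻¹ : ℝ) : ℂ) f (((‖g‖⁻¹ : ℝ) : ℂ) • g),
      elemK_smul_right ((‖g‖⁻¹ : ℝ) : ℂ) f g] with p h1 h2 hL
    have a1 : (‖f‖ : ℂ) ≠ 0 := by exact_mod_cast hf'.ne'
    have a2 : (‖g‖ : ℂ) ≠ 0 := by exact_mod_cast hg'.ne'
    rw [Pi.sub_apply, Pi.smul_apply, h1, h2, Complex.conj_ofReal, smul_eq_mul]
    push_cast
    field_simp
    simp
  have h4 := h3.add h2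
  rw [sub_add_cancel] at h4
  convert h4 using 1
  simp

lemma mae_all {ι : Type*} [Countable ι] {P : ι → X × Y → Prop}
    (h : ∀ k, ∀ᶠ p in (ae μ ×ˢ ae ν), P k p) : ∀ᶠ p in (ae μ ×ˢ ae ν), ∀ k, P k p := by
  have h' := fun k => eventually_prod_iff.1 (h k)
  choose A hA B hB hAB using h'
  exact eventually_prod_iff.2 ⟨fun x => ∀ k, A k x, ae_all_iff.2 hA, fun y => ∀ k, B k y,
    ae_all_iff.2 hB, fun hx _ hy k => hAB k (hx k) (hy k)⟩

lemma eq_zero_key {Z : Type*} [MeasurableSpace Z] {θ : Measure Z} (ζ : ℕ → ℕ → Lp ℂ 2 θ) (c : ℕ → ℝ)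
    (hc : ∀ k, HasSum (fun n => ‖ζ k n‖ ^ 2) (c k)) (hc' : ∀ k, c k ≤ (1 / 2 : ℝ) ^ k) :
      ∀ᵐ x ∂θ, (∀ k, SqS (fun n => ζ k n x)) ∧
        Tendsto (fun k => ∑' n, ‖ζ k n x‖ ^ 2) atTop (nhds 0) := by
  have hs : SqS (fun q : ℕ × ℕ => ζ q.1 q.2) := by
    unfold SqS
    rw [summable_prod_of_nonneg (fun _ => by positivity)]
    refine ⟨fun k => (hc k).summable, ?_⟩
    refine Summable.of_nonneg_of_le (fun k => tsum_nonneg fun n => by positivity) (fun k => ?_)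
      (summable_geometric_of_lt_one (r := (1 / 2 : ℝ)) (by norm_num) (by norm_num))
    rw [(hc k).tsum_eq]; exact hc' k
  filter_upwards [ae_sqS hs] with x hx
  unfold SqS at hx
  have hx2 := (summable_prod_of_nonneg (fun _ => by positivity)).1 hx
  exact ⟨fun k => hx2.1 k, hx2.2.tendsto_atTop_zero⟩

/-- if arbitrarily small representations exist, the kernel vanishes -/
lemma Rep.eq_zero {u : X × Y → ℂ} (h : ∀ ε > 0, Rep μ ν L u ε) :
    ∀ᶠ p in (ae μ ×ˢ ae ν), p ∈ L → u p = 0 := by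
  have h' : ∀ k : ℕ, Rep μ ν L u ((1 / 2 : ℝ) ^ k) := fun k => h _ (by positivity)
  choose ξ η a b h1 h2 h3 h4 h5 using h'
  have hall : ∀ᶠ p in (ae μ ×ˢ ae ν), ∀ k, p ∈ L →
      HasSum (fun n => ξ k n p.1 * conj (η k n p.2)) (u p) := by
    exact mae_all h5
  filter_upwards [(eq_zero_key ξ a h1 h3).prod_inl _, (eq_zero_key η b h2 h4).prod_inr _, hall] with p ⟨k1, k1'⟩ ⟨k2, k2'⟩ hp hL
  have bound : ∀ k, ‖u p‖ ≤ ∑' n, ‖ξ k n p.1‖ ^ 2 + ∑' n, ‖η k n p.2‖ ^ 2 := by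
    intro k
    rw [← (hp k hL).tsum_eq, ← Summable.tsum_add (k1 k) (k2 k)]
    refine tsum_of_norm_bounded (Summable.add (k1 k) (k2 k)).hasSum (fun n => ?_)
    rw [norm_mul, RCLike.norm_conj]
    nlinarith [sq_nonneg (‖ξ k n p.1‖ - ‖η k n p.2‖), sq_nonneg (‖ξ k n p.1‖ + ‖η k n p.2‖)]
  have lim : Tendsto (fun k => ∑' n, ‖ξ k n p.1‖ ^ 2 + ∑' n, ‖η k n p.2‖ ^ 2) atTop (nhds 0) := by
    simpa using k1'.add k2'
  exact norm_le_zero_iff.1 (ge_of_tendsto' lim bound)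

end P2
end OpSynth

namespace OpSynth

section P3
open Filter
open scoped ENNReal ComplexConjugate

lemma exists_op_of_sesq {H K : Type*} [NormedAddCommGroup H] [InnerProductSpace ℂ H]
    [NormedAddCommGroup K] [InnerProductSpace ℂ K] [CompleteSpace K] (B : H → K → ℂ)
    (h1 : ∀ f f' g, B (f + f') g = B f g + B f' g) (h2 : ∀ (c : ℂ) f g, B (c • f) g = c * B f g)
    (h3 : ∀ f g g', B f (g + g') = B f g + B f g') (h4 : ∀ (c : ℂ) f g, B f (c • g) = conj c * B f g)
    (C : ℝ) (hC : 0 ≤ C) (h5 : ∀ f g, ‖B f g‖ ≤ C * ‖f‖ * ‖g‖) :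
    ∃ R : H →L[ℂ] K, ∀ f g, ⟪g, R f⟫ = B f g := by
  let F : H → StrongDual ℂ K := fun f => LinearMap.mkContinuous
    { toFun := fun g => conj (B f g)
      map_add' := fun g g' => by rw [h3, map_add]
      map_smul' := fun c g => by rw [h4, map_mul, Complex.conj_conj]; rfl } (C * ‖f‖)
      (fun g => by simpa using h5 f g)
  let v : H → K := fun f => (InnerProductSpace.toDual ℂ K).symm (F f)
  have hv : ∀ f g, ⟪g, v f⟫ = B f g := by
    intro f g
    have : ⟪v f, g⟫ = conj (B f g) := by
      simp only [v, InnerProductSpace.toDual_symm_apply]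
      rfl
    rw [← inner_conj_symm, this, Complex.conj_conj]
  refine ⟨LinearMap.mkContinuous
    { toFun := v
      map_add' := fun f f' => ext_inner_left ℂ fun g => by
        rw [inner_add_right, hv, hv, hv, h1]
      map_smul' := fun c f => ext_inner_left ℂ fun g => by
        rw [inner_smul_right, hv, hv, h2]; rfl } C ?_, fun f g => hv f g⟩
  intro f
  change ‖v f‖ ≤ C * ‖f‖
  by_cases h0 : v f = 0
  · rw [h0, norm_zero]; positivity
  · have a := h5 f (v f)
    rw [← hv, inner_self_eq_norm_sq_to_K] at a
    have hpos := norm_pos_iff.2 h0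
    have b : ‖((‖v f‖ : ℂ)) ^ 2‖ = ‖v f‖ * ‖v f‖ := by
      rw [norm_pow, Complex.norm_real, norm_norm, sq]
    have a' : ‖v f‖ * ‖v f‖ ≤ C * ‖f‖ * ‖v f‖ := by
      rw [← b]; exact a
    exact le_of_mul_le_mul_right a' hpos

variable {X Y : Type*} [MeasurableSpace X] [MeasurableSpace Y] {μ : Measure X} {ν : Measure Y}
variable {L : Set (X × Y)}

def TT (μ : Measure X) (ν : Measure Y) (L : Set (X × Y)) : Submodule ℂ (X × Y → ℂ) where
  carrier := {u | ∃ C, Rep μ ν L u C}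
  zero_mem' := ⟨0, Rep.of_ae_zero (by simp)⟩
  add_mem' := by
    rintro a b ⟨C, h⟩ ⟨D, h'⟩
    exact ⟨_, h.add h'⟩
  smul_mem' := by
    rintro c a ⟨C, h⟩
    exact ⟨_, h.smul c⟩

def Nv (μ : Measure X) (ν : Measure Y) (L : Set (X × Y)) (u : X × Y → ℂ) : ℝ :=
  sInf {C | Rep μ ν L u C}

lemma Nv_le {u : X × Y → ℂ} {C : ℝ} (h : Rep μ ν L u C) : Nv μ ν L u ≤ C :=
  csInf_le ⟨0, fun _ h => h.nonneg⟩ h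

lemma Nv_nonneg {u : X × Y → ℂ} : 0 ≤ Nv μ ν L u :=
  Real.sInf_nonneg fun _ h => Rep.nonneg h

lemma rep_of_Nv_lt {u : X × Y → ℂ} (hu : u ∈ TT μ ν L) {C : ℝ} (h : Nv μ ν L u < C) :
    Rep μ ν L u C := by
  obtain ⟨D, hD, h'⟩ := exists_lt_of_csInf_lt hu h
  exact Rep.mono hD h'.le

def NvS (μ : Measure X) (ν : Measure Y) (L : Set (X × Y)) : Seminorm ℂ (TT μ ν L) :=
  Seminorm.ofSMulLE (fun u => Nv μ ν L u)
    (le_antisymm (Nv_le (Rep.of_ae_zero (by simp))) Nv_nonneg)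
    (fun u v => by
      refine le_of_forall_pos_le_add fun ε hε => ?_
      have h1 := rep_of_Nv_lt u.2 (show Nv μ ν L u < Nv μ ν L u + ε / 2 by linarith)
      have h2 := rep_of_Nv_lt v.2 (show Nv μ ν L v < Nv μ ν L v + ε / 2 by linarith)
      have h3 := Nv_le (h1.add h2)
      rw [Submodule.coe_add]
      linarith)
    (fun c u => by
      refine le_of_forall_pos_le_add fun ε hε => ?_
      have h1 := rep_of_Nv_lt u.2 (show Nv μ ν L u < Nv μ ν L u + ε / (‖c‖ + 1) by
        have : 0 < ε / (‖c‖ + 1) := by positivity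
        linarith)
      have h3 := Nv_le (h1.smul c)
      rw [Submodule.coe_smul]
      refine h3.trans ?_
      rw [mul_add]
      gcongr
      rw [mul_div_assoc', div_le_iff₀ (by positivity)]
      nlinarith [norm_nonneg c])

lemma exists_phi {u : X × Y → ℂ} (hu : u ∈ TT μ ν L)
    (h : ¬ ∀ᶠ p in (ae μ ×ˢ ae ν), p ∈ L → u p = 0) :
    ∃ φ : (X × Y → ℂ) →ₗ[ℂ] ℂ, (∀ v C, Rep μ ν L v C → ‖φ v‖ ≤ C) ∧ φ u ≠ 0 := by
  have hN : Nv μ ν L u ≠ 0 := by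
    intro h0
    refine h (Rep.eq_zero fun ε hε => rep_of_Nv_lt hu (by rw [h0]; exact hε))
  have hN' : 0 < Nv μ ν L u := lt_of_le_of_ne Nv_nonneg (Ne.symm hN)
  let u' : TT μ ν L := ⟨u, hu⟩
  have hu0 : u' ≠ 0 := by
    intro h0
    apply hN
    have : u = 0 := congrArg Subtype.val h0
    rw [this]
    exact map_zero (NvS μ ν L)
  let c := LinearEquiv.coord ℂ (TT μ ν L) u' hu0
  let f : Module.Dual ℂ (ℂ ∙ u') := ((Nv μ ν L u : ℝ) : ℂ) • c.toLinearMap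
  obtain ⟨ψ, h1, h2⟩ := Module.Dual.exists_extension_of_le_seminorm (ℂ ∙ u') f (p := NvS μ ν L) (by
    rintro ⟨x, hx⟩
    obtain ⟨a, rfl⟩ := Submodule.mem_span_singleton.1 hx
    have e : c ⟨a • u', hx⟩ = a := by
      have : (⟨a • u', hx⟩ : (ℂ ∙ u')) = a • ⟨u', Submodule.mem_span_singleton_self u'⟩ := rfl
      rw [this, map_smul]
      simp [c, LinearEquiv.coord_self]
    change ‖((Nv μ ν L u : ℝ) : ℂ) * c ⟨a • u', hx⟩‖ ≤ NvS μ ν L (a • u')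
    rw [e, map_smul_eq_mul, norm_mul, Complex.norm_real, Real.norm_eq_abs, abs_of_pos hN', mul_comm]
    rfl)
  obtain ⟨φ, hφ⟩ := LinearMap.exists_extend ψ
  have hφ' : ∀ v : TT μ ν L, φ v = ψ v := fun v => by rw [← hφ]; rfl
  refine ⟨φ, ?_, ?_⟩
  · intro v C hv
    have := h2 ⟨v, ⟨C, hv⟩⟩
    rw [← hφ'] at this
    exact this.trans (Nv_le hv)
  · have := h1 ⟨u', Submodule.mem_span_singleton_self u'⟩
    rw [← hφ'] at this
    change φ u = _ at this
    rw [this]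
    change ((Nv μ ν L u : ℝ) : ℂ) * c _ ≠ 0
    simp only [c, LinearEquiv.coord_self]
    simpa using hN

/-- Key existence lemma. -/
lemma exists_hb (f : Lp ℂ 2 μ) (g : Lp ℂ 2 ν)
    (h : ¬ ∀ᶠ p in (ae μ ×ˢ ae ν), p ∈ L → elemK f g p = 0) :
    ∃ R : Lp ℂ 2 μ →L[ℂ] Lp ℂ 2 ν, ⟪g, R f⟫ ≠ 0 ∧
      ∀ (ξ : ℕ → Lp ℂ 2 μ) (η : ℕ → Lp ℂ 2 ν), SqS ξ → SqS η → KerRep μ ν L ξ η 0 →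
        ∑' n, ⟪η n, R (ξ n)⟫ = 0 := by
  obtain ⟨φ, hφ, hne⟩ := exists_phi ⟨_, Rep.single f g⟩ h
  have hφ0 : ∀ v w, (∀ᶠ p in (ae μ ×ˢ ae ν), v p = w p) → φ v = φ w := by
    intro v w hvw
    have := hφ (v - w) 0 (Rep.of_ae_zero (by
      filter_upwards [hvw] with p hp _
      rw [Pi.sub_apply, hp, sub_self]))
    rw [map_sub] at this
    exact sub_eq_zero.1 (norm_le_zero_iff.1 this)
  obtain ⟨R, hR⟩ := exists_op_of_sesq (fun (f : Lp ℂ 2 μ) (g : Lp ℂ 2 ν) => φ (elemK f g))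
    (fun f f' g => by rw [← map_add]; exact hφ0 _ _ (elemK_add_left f f' g))
    (fun c f g => by
      rw [← smul_eq_mul, ← map_smul]; exact hφ0 _ _ (elemK_smul_left c f g))
    (fun f g g' => by rw [← map_add]; exact hφ0 _ _ (elemK_add_right f g g'))
    (fun c f g => by
      rw [← smul_eq_mul, ← map_smul]; exact hφ0 _ _ (elemK_smul_right c f g))
    1 zero_le_one (fun f g => by rw [one_mul]; exact hφ _ _ (Rep.single f g))
  refine ⟨R, by rw [hR]; exact hne, ?_⟩
  intro ξ η hξ hη hk
  have hs := (hξ.pair hη R).hasSum.tendsto_sum_nat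
  refine tendsto_nhds_unique hs ?_
  have e : ∀ N, ∑ n ∈ Finset.range N, ⟪η n, R (ξ n)⟫ = φ (∑ n ∈ Finset.range N, elemK (ξ n) (η n)) := by
    intro N
    rw [map_sum]
    exact Finset.sum_congr rfl fun n _ => hR _ _
  have t1 := tendsto_sum_nat_add fun n => ‖ξ n‖ ^ 2
  have t2 := tendsto_sum_nat_add fun n => ‖η n‖ ^ 2
  have t3 := t1.add t2
  rw [add_zero] at t3
  refine squeeze_zero_norm (fun N => ?_) t3
  rw [e, ← norm_neg, ← map_neg]
  refine hφ _ _ ⟨fun n => ξ (n + N), fun n => η (n + N), _, _,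
    ((summable_nat_add_iff N).2 hξ).hasSum, ((summable_nat_add_iff N).2 hη).hasSum,
    le_add_of_nonneg_right (tsum_nonneg fun n => by positivity),
    le_add_of_nonneg_left (tsum_nonneg fun n => by positivity), ?_⟩
  filter_upwards [hk] with p hp hL
  have := (hasSum_nat_add_iff' N).2 (hp hL)
  have e2 : (-∑ n ∈ Finset.range N, elemK (ξ n) (η n)) p = (0 : X × Y → ℂ) p -
      ∑ i ∈ Finset.range N, ξ i p.1 * conj (η i p.2) := by
    rw [Pi.neg_apply, Pi.zero_apply, zero_sub, Finset.sum_apply]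
    rfl
  rw [e2]
  exact this

end P3
end OpSynth

namespace OpSynth

section P4
open Filter
open scoped ENNReal ComplexConjugate

section gen
variable {H K : Type*} [NormedAddCommGroup H] [InnerProductSpace ℂ H]
    [NormedAddCommGroup K] [InnerProductSpace ℂ K]

lemma SqS.map {ι : Type*} {ξ : ι → H} (h : SqS ξ) (A : H →L[ℂ] K) : SqS (fun n => A (ξ n)) := by
  refine Summable.of_nonneg_of_le (fun n => by positivity) (fun n => ?_) (h.mul_left (‖A‖ ^ 2))
  rw [← mul_pow]
  gcongr
  exact A.le_opNorm _

lemma inner_zero_of_ref {W : Set (H →L[ℂ] K)} {T : H →L[ℂ] K} (hT : T ∈ RefHull W) {x : H} {g : K}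
    (h : ∀ S ∈ W, ⟪g, S x⟫ = 0) : ⟪g, T x⟫ = 0 := by
  have hc : IsClosed {v : K | ⟪g, v⟫ = 0} :=
    isClosed_eq (continuous_const.inner continuous_id) continuous_const
  refine closure_minimal ?_ hc (hT x)
  rintro _ ⟨S, hS, rfl⟩
  exact h S hS

lemma exists_inner_of_not_ref [CompleteSpace K] {W : Set (H →L[ℂ] K)}
    (hW : ∃ M : Submodule ℂ (H →L[ℂ] K), (M : Set (H →L[ℂ] K)) = W) {T : H →L[ℂ] K} {x : H}
    (h : T x ∉ closure ((fun S : H →L[ℂ] K => S x) '' W)) :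
    ∃ g, (∀ S ∈ W, ⟪g, S x⟫ = 0) ∧ ⟪g, T x⟫ ≠ 0 := by
  obtain ⟨M, rfl⟩ := hW
  let ev : (H →L[ℂ] K) →ₗ[ℂ] K :=
    { toFun := fun S => S x, map_add' := fun _ _ => rfl, map_smul' := fun _ _ => rfl }
  have e : ((M.map ev).topologicalClosure : Set K) =
      closure ((fun S : H →L[ℂ] K => S x) '' (M : Set (H →L[ℂ] K))) := by
    rw [Submodule.topologicalClosure_coe, Submodule.map_coe]; rfl
  rw [← e, SetLike.mem_coe, ← Submodule.orthogonal_orthogonal_eq_closure,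
    Submodule.mem_orthogonal] at h
  push Not at h
  obtain ⟨g, hg, hne⟩ := h
  refine ⟨g, fun S hS => ?_, hne⟩
  rw [Submodule.mem_orthogonal] at hg
  exact inner_eq_zero_symm.1 (hg _ (Submodule.mem_map_of_mem hS))

lemma subset_refHull (W : Set (H →L[ℂ] K)) : W ⊆ RefHull W :=
  fun T hT x => subset_closure ⟨T, hT, rfl⟩

lemma refHull_mono {W W' : Set (H →L[ℂ] K)} (h : W ⊆ W') : RefHull W ⊆ RefHull W' :=
  fun T hT x => closure_mono (image_mono h) (hT x)

end gen

variable {X Y : Type*} [MeasurableSpace X] [MeasurableSpace Y] {μ : Measure X} {ν : Measure Y}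
variable {L : Set (X × Y)}

lemma memLp_mul {φ : X → ℂ} (hφ : AEStronglyMeasurable φ μ) {C : ℝ} (hC : ∀ᵐ x ∂μ, ‖φ x‖ ≤ C)
    (f : Lp ℂ 2 μ) : MemLp (fun x => φ x * f x) 2 μ := by
  refine MemLp.of_le_mul (c := C) (Lp.memLp f) (hφ.mul (Lp.aestronglyMeasurable f)) ?_
  filter_upwards [hC] with x hx
  rw [norm_mul]
  gcongr

/-- multiplication operator -/
def mulOp (φ : X → ℂ) (hφ : AEStronglyMeasurable φ μ) (C : ℝ) (hC : ∀ᵐ x ∂μ, ‖φ x‖ ≤ C) :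
    Lp ℂ 2 μ →L[ℂ] Lp ℂ 2 μ :=
  LinearMap.mkContinuous
    { toFun := fun f => (memLp_mul hφ hC f).toLp _
      map_add' := fun f g => by
        apply Lp.ext
        filter_upwards [(memLp_mul hφ hC f).coeFn_toLp, (memLp_mul hφ hC g).coeFn_toLp,
          (memLp_mul hφ hC (f + g)).coeFn_toLp, Lp.coeFn_add f g,
          Lp.coeFn_add ((memLp_mul hφ hC f).toLp _) ((memLp_mul hφ hC g).toLp _)] with x h1 h2 h3 h4 h5
        rw [h5, Pi.add_apply, h1, h2, h3, h4, Pi.add_apply, mul_add]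
      map_smul' := fun c f => by
        apply Lp.ext
        filter_upwards [(memLp_mul hφ hC f).coeFn_toLp,
          (memLp_mul hφ hC (c • f)).coeFn_toLp, Lp.coeFn_smul c f,
          Lp.coeFn_smul c ((memLp_mul hφ hC f).toLp _)] with x h1 h3 h4 h5
        rw [RingHom.id_apply, h5, Pi.smul_apply, h1, h3, h4, Pi.smul_apply, smul_eq_mul, smul_eq_mul]
        ring } C
    (fun f => by
      apply Lp.norm_le_mul_norm_of_ae_le_mul
      filter_upwards [(memLp_mul hφ hC f).coeFn_toLp, hC] with x h1 h2
      change ‖((memLp_mul hφ hC f).toLp _ : Lp ℂ 2 μ) x‖ ≤ _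
      rw [h1, norm_mul]
      gcongr)

lemma mulOp_coe (φ : X → ℂ) (hφ : AEStronglyMeasurable φ μ) (C : ℝ) (hC : ∀ᵐ x ∂μ, ‖φ x‖ ≤ C)
    (f : Lp ℂ 2 μ) : ⇑(mulOp φ hφ C hC f) =ᵐ[μ] fun x => φ x * f x :=
  (memLp_mul hφ hC f).coeFn_toLp

lemma isMultOp_mulOp (φ : X → ℂ) (hφ : AEStronglyMeasurable φ μ) (C : ℝ)
    (hC : ∀ᵐ x ∂μ, ‖φ x‖ ≤ C) : IsMultOp μ (mulOp φ hφ C hC) :=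
  ⟨φ, hφ, ⟨C, hC⟩, mulOp_coe φ hφ C hC⟩

/-- the adjoint of a multiplication operator -/
lemma adjoint_mult {A : Lp ℂ 2 μ →L[ℂ] Lp ℂ 2 μ} {φ : X → ℂ} (hφ : AEStronglyMeasurable φ μ)
    {C : ℝ} (hC : ∀ᵐ x ∂μ, ‖φ x‖ ≤ C) (hA : ∀ f : Lp ℂ 2 μ, ⇑(A f) =ᵐ[μ] fun x => φ x * f x)
    (g : Lp ℂ 2 μ) : ⇑(ContinuousLinearMap.adjoint A g) =ᵐ[μ] fun x => conj (φ x) * g x := by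
  have hφ' : AEStronglyMeasurable (fun x => conj (φ x)) μ :=
    RCLike.continuous_conj.comp_aestronglyMeasurable hφ
  have hC' : ∀ᵐ x ∂μ, ‖conj (φ x)‖ ≤ C := by
    filter_upwards [hC] with x hx; rwa [RCLike.norm_conj]
  have : ContinuousLinearMap.adjoint A g = mulOp _ hφ' C hC' g := by
    refine ext_inner_left ℂ fun f => ?_
    rw [ContinuousLinearMap.adjoint_inner_right, L2.inner_def, L2.inner_def]
    refine integral_congr_ae ?_
    filter_upwards [hA f, mulOp_coe _ hφ' C hC' g] with x h1 h2
    rw [h1, h2, RCLike.inner_apply, RCLike.inner_apply, map_mul]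
    ring
  rw [this]
  exact mulOp_coe _ hφ' C hC' g

/-! ### Mmax -/

lemma mem_Mmax_iff {T : Lp ℂ 2 μ →L[ℂ] Lp ℂ 2 ν} : T ∈ Mmax μ ν L ↔
    ∀ (α : Set X) (β : Set Y), MeasurableSet α → MeasurableSet β →
    MargNull μ ν ((α ×ˢ β) ∩ L) →
    ∀ (f : Lp ℂ 2 μ) (g : Lp ℂ 2 ν),
      (∀ᵐ x ∂μ, x ∉ α → f x = 0) → (∀ᵐ y ∂ν, y ∉ β → g y = 0) →
      ⟪g, T f⟫ = 0 := by
  constructor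
  · intro h α β h1 h2 h3 f g h4 h5
    exact inner_eq_zero_symm.1 (h α β h1 h2 h3 f g h4 h5)
  · intro h α β h1 h2 h3 f g h4 h5
    exact inner_eq_zero_symm.1 (h α β h1 h2 h3 f g h4 h5)

def MmaxS (μ : Measure X) (ν : Measure Y) (L : Set (X × Y)) :
    Submodule ℂ (Lp ℂ 2 μ →L[ℂ] Lp ℂ 2 ν) where
  carrier := Mmax μ ν L
  zero_mem' := mem_Mmax_iff.2 fun α β h1 h2 h3 f g h4 h5 => by simp
  add_mem' := fun {S T} hS hT => mem_Mmax_iff.2 fun α β h1 h2 h3 f g h4 h5 => by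
    rw [ContinuousLinearMap.add_apply, inner_add_right, mem_Mmax_iff.1 hS α β h1 h2 h3 f g h4 h5,
      mem_Mmax_iff.1 hT α β h1 h2 h3 f g h4 h5, add_zero]
  smul_mem' := fun c T hT => mem_Mmax_iff.2 fun α β h1 h2 h3 f g h4 h5 => by
    rw [ContinuousLinearMap.smul_apply, inner_smul_right,
      mem_Mmax_iff.1 hT α β h1 h2 h3 f g h4 h5, mul_zero]

lemma Mmax_wk : IsWkClosedSubspace (Mmax μ ν L) := by
  refine ⟨⟨MmaxS μ ν L, rfl⟩, ?_⟩
  have : Mmax μ ν L = ⋂ (q : {q : (Set X × Set Y) × (Lp ℂ 2 μ × Lp ℂ 2 ν) // MeasurableSet q.1.1 ∧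
      MeasurableSet q.1.2 ∧ MargNull μ ν ((q.1.1 ×ˢ q.1.2) ∩ L) ∧
      (∀ᵐ x ∂μ, x ∉ q.1.1 → q.2.1 x = 0) ∧ (∀ᵐ y ∂ν, y ∉ q.1.2 → q.2.2 y = 0)}),
      {T | ⟪q.1.2.2, T q.1.2.1⟫ = 0} := by
    ext T
    rw [mem_Mmax_iff, mem_iInter]
    constructor
    · rintro h ⟨⟨⟨α, β⟩, f, g⟩, h1, h2, h3, h4, h5⟩
      exact h α β h1 h2 h3 f g h4 h5
    · intro h α β h1 h2 h3 f g h4 h5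
      exact h ⟨⟨⟨α, β⟩, f, g⟩, h1, h2, h3, h4, h5⟩
  rw [this]
  unfold WkClosed
  refine @isClosed_iInter _ _ (sigmaWeak _ _) _ fun q => ?_
  exact wkClosed_inner _ _

lemma Mmax_bimodule : IsMultBimodule μ ν (Mmax μ ν L) := by
  refine ⟨Mmax_wk, ?_⟩
  rintro T hT A B ⟨φ, hφ, ⟨C, hC⟩, hA⟩ ⟨ψ, hψ, ⟨D, hD⟩, hB⟩
  refine mem_Mmax_iff.2 fun α β h1 h2 h3 f g h4 h5 => ?_
  rw [ContinuousLinearMap.comp_apply, ContinuousLinearMap.comp_apply,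
    ← ContinuousLinearMap.adjoint_inner_left]
  refine mem_Mmax_iff.1 hT α β h1 h2 h3 _ _ ?_ ?_
  · filter_upwards [hA f, h4] with x e1 e2 hx
    rw [e1, e2 hx, mul_zero]
  · filter_upwards [adjoint_mult hψ hD hB g, h5] with x e1 e2 hx
    rw [e1, e2 hx, mul_zero]

lemma refHull_Mmax : RefHull (Mmax μ ν L) = Mmax μ ν L := by
  refine subset_antisymm ?_ (subset_refHull _)
  intro T hT
  refine mem_Mmax_iff.2 fun α β h1 h2 h3 f g h4 h5 => ?_
  exact inner_zero_of_ref hT fun S hS => mem_Mmax_iff.1 hS α β h1 h2 h3 f g h4 h5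

/-! ### Vk -/

def Vk (μ : Measure X) (ν : Measure Y) (L : Set (X × Y)) : Set (Lp ℂ 2 μ →L[ℂ] Lp ℂ 2 ν) :=
  {R | ∀ (ξ : ℕ → Lp ℂ 2 μ) (η : ℕ → Lp ℂ 2 ν), SqS ξ → SqS η → KerRep μ ν L ξ η 0 →
        ∑' n, ⟪η n, R (ξ n)⟫ = 0}

def VkS (μ : Measure X) (ν : Measure Y) (L : Set (X × Y)) :
    Submodule ℂ (Lp ℂ 2 μ →L[ℂ] Lp ℂ 2 ν) where
  carrier := Vk μ ν L
  zero_mem' := fun ξ η _ _ _ => by simp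
  add_mem' := fun {S T} hS hT ξ η h1 h2 h3 => by
    have : (fun n => ⟪η n, (S + T) (ξ n)⟫) = fun n => ⟪η n, S (ξ n)⟫ + ⟪η n, T (ξ n)⟫ :=
      funext fun n => by rw [ContinuousLinearMap.add_apply, inner_add_right]
    rw [this, (h1.pair h2 S).tsum_add (h1.pair h2 T), hS ξ η h1 h2 h3, hT ξ η h1 h2 h3, add_zero]
  smul_mem' := fun c T hT ξ η h1 h2 h3 => by
    have : (fun n => ⟪η n, (c • T) (ξ n)⟫) = fun n => c * ⟪η n, T (ξ n)⟫ :=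
      funext fun n => by rw [ContinuousLinearMap.smul_apply, inner_smul_right]
    rw [this, tsum_mul_left, hT ξ η h1 h2 h3, mul_zero]

lemma Vk_wk : IsWkClosedSubspace (Vk μ ν L) := by
  refine ⟨⟨VkS μ ν L, rfl⟩, ?_⟩
  have : Vk μ ν L = ⋂ (q : {q : (ℕ → Lp ℂ 2 μ) × (ℕ → Lp ℂ 2 ν) // SqS q.1 ∧ SqS q.2 ∧
      KerRep μ ν L q.1 q.2 0}), {R | ∑' n, ⟪q.1.2 n, R (q.1.1 n)⟫ = 0} := by
    ext T
    rw [mem_iInter]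
    constructor
    · rintro h ⟨⟨ξ, η⟩, h1, h2, h3⟩
      exact h ξ η h1 h2 h3
    · intro h ξ η h1 h2 h3
      exact h ⟨⟨ξ, η⟩, h1, h2, h3⟩
  rw [this]
  unfold WkClosed
  refine @isClosed_iInter _ _ (sigmaWeak _ _) _ fun q => ?_
  exact wkClosed_pair q.2.1 q.2.2.1

lemma Vk_bimodule : IsMultBimodule μ ν (Vk μ ν L) := by
  refine ⟨Vk_wk, ?_⟩
  rintro T hT A B ⟨φ, hφ, ⟨C, hC⟩, hA⟩ ⟨ψ, hψ, ⟨D, hD⟩, hB⟩ ξ η h1 h2 h3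
  have e : (fun n => ⟪η n, (B ∘L T ∘L A) (ξ n)⟫) =
      fun n => ⟪ContinuousLinearMap.adjoint B (η n), T (A (ξ n))⟫ := funext fun n => by
    rw [ContinuousLinearMap.comp_apply, ContinuousLinearMap.comp_apply,
      ← ContinuousLinearMap.adjoint_inner_left]
  rw [e]
  refine hT _ _ (h1.map A) (h2.map _) ?_
  have a1 : ∀ᵐ x ∂μ, ∀ n, A (ξ n) x = φ x * ξ n x := ae_all_iff.2 fun n => hA (ξ n)
  have a2 : ∀ᵐ x ∂ν, ∀ n, ContinuousLinearMap.adjoint B (η n) x = conj (ψ x) * η n x :=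
    ae_all_iff.2 fun n => adjoint_mult hψ hD hB (η n)
  filter_upwards [h3, a1.prod_inl _, a2.prod_inr _] with p h3 a1 a2 hL
  have e : (fun n => A (ξ n) p.1 * conj (ContinuousLinearMap.adjoint B (η n) p.2)) =
      fun n => (φ p.1 * ψ p.2) * (ξ n p.1 * conj (η n p.2)) := funext fun n => by
    rw [a1, a2, map_mul, Complex.conj_conj]; ring
  rw [e]
  simpa using (h3 hL).mul_left (φ p.1 * ψ p.2)

lemma KerRep.congr {ι : Type*} {ξ : ι → Lp ℂ 2 μ} {η : ι → Lp ℂ 2 ν} {u v : X × Y → ℂ}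
    (h : KerRep μ ν L ξ η u) (h' : ∀ᶠ p in (ae μ ×ˢ ae ν), p ∈ L → u p = v p) :
    KerRep μ ν L ξ η v := by
  filter_upwards [h, h'] with p hp hp' hL
  rw [← hp' hL]; exact hp hL

lemma kerRep_single (f : Lp ℂ 2 μ) (g : Lp ℂ 2 ν) :
    KerRep μ ν L (Pi.single (M := fun _ : ℕ => Lp ℂ 2 μ) 0 f)
      (Pi.single (M := fun _ : ℕ => Lp ℂ 2 ν) 0 g) (elemK f g) := by
  have h1 : ∀ᵐ x ∂μ, (0 : Lp ℂ 2 μ) x = 0 := Lp.coeFn_zero _ _ _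
  filter_upwards [h1.prod_inl _] with p h1 hL
  convert hasSum_single (f := fun n => (Pi.single 0 f : ℕ → Lp ℂ 2 μ) n p.1 *
      conj ((Pi.single 0 g : ℕ → Lp ℂ 2 ν) n p.2)) 0 ?_ using 1
  · rw [Pi.single_eq_same, Pi.single_eq_same]; rfl
  · intro n hn; rw [Pi.single_eq_of_ne hn, h1, zero_mul]

lemma elemK_rect {α : Set X} {β : Set Y} (h : MargNull μ ν ((α ×ˢ β) ∩ L)) {f : Lp ℂ 2 μ}
    {g : Lp ℂ 2 ν} (hf : ∀ᵐ x ∂μ, x ∉ α → f x = 0) (hg : ∀ᵐ y ∂ν, y ∉ β → g y = 0) :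
    ∀ᶠ p in (ae μ ×ˢ ae ν), p ∈ L → elemK f g p = 0 := by
  filter_upwards [margNull_iff.1 h, hf.prod_inl _, hg.prod_inr _] with p h1 h2 h3 hL
  simp only [elemK]
  by_cases ha : p.1 ∈ α
  · by_cases hb : p.2 ∈ β
    · exact absurd ⟨⟨ha, hb⟩, hL⟩ h1
    · rw [h3 hb, map_zero, mul_zero]
  · rw [h2 ha, zero_mul]

lemma Vk_elem {R : Lp ℂ 2 μ →L[ℂ] Lp ℂ 2 ν} (hR : R ∈ Vk μ ν L) {f : Lp ℂ 2 μ} {g : Lp ℂ 2 ν}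
    (h : ∀ᶠ p in (ae μ ×ˢ ae ν), p ∈ L → elemK f g p = 0) : ⟪g, R f⟫ = 0 := by
  rw [← tsum_pi_single f g R]
  exact hR _ _ (sqS_pi_single f) (sqS_pi_single g) ((kerRep_single f g).congr h)

lemma Vk_sub_Mmax : Vk μ ν L ⊆ Mmax μ ν L := fun R hR =>
  mem_Mmax_iff.2 fun α β h1 h2 h3 f g h4 h5 => Vk_elem hR (elemK_rect h3 h4 h5)

lemma measurableSet_supp (f : Lp ℂ 2 μ) : MeasurableSet {x | f x ≠ 0} :=
  (Lp.stronglyMeasurable f).measurable (measurableSet_singleton (0 : ℂ)).compl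

lemma Mmax_elem {T : Lp ℂ 2 μ →L[ℂ] Lp ℂ 2 ν} (hT : T ∈ Mmax μ ν L) {f : Lp ℂ 2 μ} {g : Lp ℂ 2 ν}
    (h : ∀ᶠ p in (ae μ ×ˢ ae ν), p ∈ L → elemK f g p = 0) : ⟪g, T f⟫ = 0 := by
  refine mem_Mmax_iff.1 hT {x | f x ≠ 0} {y | g y ≠ 0} (measurableSet_supp f) (measurableSet_supp g)
    (margNull_iff.2 ?_) f g (by simp) (by simp)
  filter_upwards [h] with p hp
  rintro ⟨⟨h1, h2⟩, hL⟩
  have := hp hL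
  simp only [elemK, mul_eq_zero, map_eq_zero] at this
  rcases this with h | h
  · exact h1 h
  · exact h2 h

lemma refHull_Vk : RefHull (Vk μ ν L) = Mmax μ ν L := by
  refine subset_antisymm ?_ ?_
  · rw [← refHull_Mmax (L := L)]; exact refHull_mono Vk_sub_Mmax
  · intro T hT f
    by_contra hn
    obtain ⟨g, h1, h2⟩ := exists_inner_of_not_ref Vk_wk.1 hn
    obtain ⟨R, hR1, hR2⟩ := exists_hb f g (L := L) (fun h => h2 (Mmax_elem hT h))
    exact hR1 (h1 R hR2)

lemma lemma_M_nat (hL : OperatorSynthetic μ ν L) : Mmax μ ν L ⊆ Vk μ ν L := by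
  rw [← hL.2]
  exact sInter_subset_of_mem ⟨Vk_bimodule, hL.1, refHull_Vk⟩

lemma lemma_M (hL : OperatorSynthetic μ ν L) {R : Lp ℂ 2 μ →L[ℂ] Lp ℂ 2 ν} (hR : R ∈ Mmax μ ν L)
    {ι : Type*} [Countable ι] {ξ : ι → Lp ℂ 2 μ} {η : ι → Lp ℂ 2 ν} (h1 : SqS ξ) (h2 : SqS η)
    (h3 : KerRep μ ν L ξ η 0) : ∑' n, ⟪η n, R (ξ n)⟫ = 0 := by
  obtain ⟨e, he⟩ := exists_injective_nat ι
  rw [← tsum_extend_pair he R]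
  refine lemma_M_nat hL hR _ _ (h1.extend he) (h2.extend he) ?_
  have a1 : ∀ᵐ x ∂μ, (0 : Lp ℂ 2 μ) x = 0 := Lp.coeFn_zero _ _ _
  filter_upwards [a1.prod_inl _, h3] with p a1 hp hL
  rw [extend_pair he (fun (a : Lp ℂ 2 μ) (b : Lp ℂ 2 ν) => a p.1 * conj (b p.2))
    (by rw [a1, zero_mul])]
  exact (hasSum_extend_zero he).2 (hp hL)

end P4
end OpSynth

namespace OpSynth

section P5
open Filter
open scoped ENNReal ComplexConjugate

lemma cs_tsum {a b : ℕ → ℝ} (ha0 : ∀ n, 0 ≤ a n) (hb0 : ∀ n, 0 ≤ b n)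
    (ha : Summable fun n => a n ^ 2) (hb : Summable fun n => b n ^ 2) {A B : ℝ} (hA0 : 0 ≤ A)
    (hB0 : 0 ≤ B) (hA : ∑' n, a n ^ 2 ≤ A ^ 2) (hB : ∑' n, b n ^ 2 ≤ B ^ 2) :
    ∑' n, a n * b n ≤ A * B := by
  refine Real.tsum_le_of_sum_le (fun n => mul_nonneg (ha0 n) (hb0 n)) fun s => ?_
  refine abs_le_of_sq_le_sq' ?_ (by positivity) |>.2
  calc (∑ i ∈ s, a i * b i) ^ 2 ≤ (∑ i ∈ s, a i ^ 2) * ∑ i ∈ s, b i ^ 2 :=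
        Finset.sum_mul_sq_le_sq_mul_sq _ _ _
    _ ≤ A ^ 2 * B ^ 2 := by
        gcongr
        · exact (ha.sum_le_tsum s fun i _ => by positivity).trans hA
        · exact (hb.sum_le_tsum s fun i _ => by positivity).trans hB
    _ = (A * B) ^ 2 := by ring

section gen
variable {H K : Type*} [NormedAddCommGroup H] [InnerProductSpace ℂ H]
    [NormedAddCommGroup K] [InnerProductSpace ℂ K]

lemma pair_bound {a : ℕ → H} {b : ℕ → K} (ha : SqS a) (hb : SqS b) {A B : ℝ} (hA0 : 0 ≤ A)
    (hB0 : 0 ≤ B) (hA : ∑' n, ‖a n‖ ^ 2 ≤ A ^ 2) (hB : ∑' n, ‖b n‖ ^ 2 ≤ B ^ 2) (T : H →L[ℂ] K) :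
    ‖∑' n, ⟪b n, T (a n)⟫‖ ≤ ‖T‖ * (A * B) := by
  have hs : Summable fun n => ‖a n‖ * ‖b n‖ := by
    have := ha.norm_pair hb
    simpa only [mul_comm] using this
  have h1 : ‖∑' n, ⟪b n, T (a n)⟫‖ ≤ ∑' n, ‖T‖ * (‖a n‖ * ‖b n‖) := by
    refine tsum_of_norm_bounded (hs.mul_left _).hasSum fun n => ?_
    calc ‖⟪b n, T (a n)⟫‖ ≤ ‖b n‖ * ‖T (a n)‖ := norm_inner_le_norm _ _
      _ ≤ ‖b n‖ * (‖T‖ * ‖a n‖) := by gcongr; exact T.le_opNorm _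
      _ = _ := by ring
  refine h1.trans ?_
  rw [tsum_mul_left]
  gcongr
  exact cs_tsum (fun n => norm_nonneg _) (fun n => norm_nonneg _) ha hb hA0 hB0 hA hB

lemma SqS.smul_vec {p : ℕ → ℂ} (hp : SqS p) (f : H) : SqS (fun n => p n • f) := by
  unfold SqS
  simp only [norm_smul, mul_pow]
  exact Summable.mul_right _ hp

lemma approx_bound {a : ℕ → H} {b : ℕ → K} {p q : ℕ → ℂ} {f : H} {g : K} (T : H →L[ℂ] K)
    {ε P Q : ℝ} (hε : 0 ≤ ε) (hP0 : 0 ≤ P) (hQ0 : 0 ≤ Q) (hp : SqS p) (hq : SqS q)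
    (hP : ∑' n, ‖p n‖ ^ 2 ≤ P ^ 2) (hQ : ∑' n, ‖q n‖ ^ 2 ≤ Q ^ 2)
    (ha : SqS fun n => a n - p n • f) (hb : SqS fun n => b n - q n • g)
    (ha' : ∑' n, ‖a n - p n • f‖ ^ 2 ≤ (ε * ‖f‖) ^ 2) (hb' : ∑' n, ‖b n - q n • g‖ ^ 2 ≤ (ε * ‖g‖) ^ 2)
    (h0 : ∑' n, ⟪b n, T (a n)⟫ = 0) :
    ‖∑' n, p n * conj (q n)‖ * ‖⟪g, T f⟫‖ ≤ ‖T‖ * (ε * (P + Q + ε) * (‖f‖ * ‖g‖)) := by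
  have n1 : ∑' n, ‖p n • f‖ ^ 2 ≤ (P * ‖f‖) ^ 2 := by
    simp only [norm_smul, mul_pow]
    rw [tsum_mul_right]; gcongr
  have n2 : ∑' n, ‖q n • g‖ ^ 2 ≤ (Q * ‖g‖) ^ 2 := by
    simp only [norm_smul, mul_pow]
    rw [tsum_mul_right]; gcongr
  have s1 := hp.smul_vec f
  have s2 := hq.smul_vec g
  have b1 := pair_bound s1 hb (by positivity) (by positivity) n1 hb' T
  have b2 := pair_bound ha s2 (by positivity) (by positivity) ha' n2 T
  have b3 := pair_bound ha hb (by positivity) (by positivity) ha' hb' T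
  have e0 : ∑' n, ⟪q n • g, T (p n • f)⟫ = (∑' n, p n * conj (q n)) * ⟪g, T f⟫ := by
    rw [← tsum_mul_right]
    refine tsum_congr fun n => ?_
    rw [inner_smul_left, map_smul, inner_smul_right]; ring
  have key : ∑' n, ⟪b n, T (a n)⟫ = ∑' n, ⟪q n • g, T (p n • f)⟫ +
      (∑' n, ⟪b n - q n • g, T (p n • f)⟫ + ∑' n, ⟪q n • g, T (a n - p n • f)⟫ +
        ∑' n, ⟪b n - q n • g, T (a n - p n • f)⟫) := by
    rw [← (s1.pair hb T).tsum_add (ha.pair s2 T),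
      ← ((s1.pair hb T).add (ha.pair s2 T)).tsum_add (ha.pair hb T),
      ← (s1.pair s2 T).tsum_add (((s1.pair hb T).add (ha.pair s2 T)).add (ha.pair hb T))]
    refine tsum_congr fun n => ?_
    simp only [map_sub, inner_sub_left, inner_sub_right]
    ring
  rw [h0, e0] at key
  have : (∑' n, p n * conj (q n)) * ⟪g, T f⟫ = -(∑' n, ⟪b n - q n • g, T (p n • f)⟫ +
      ∑' n, ⟪q n • g, T (a n - p n • f)⟫ + ∑' n, ⟪b n - q n • g, T (a n - p n • f)⟫) := by
    rw [eq_neg_iff_add_eq_zero, ← key]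
  rw [← norm_mul, this, norm_neg]
  refine (norm_add₃_le).trans ?_
  calc _ ≤ ‖T‖ * (P * ‖f‖ * (ε * ‖g‖)) + ‖T‖ * (ε * ‖f‖ * (Q * ‖g‖)) + ‖T‖ * (ε * ‖f‖ * (ε * ‖g‖)) :=
        add_le_add (add_le_add b1 b2) b3
    _ = _ := by ring

end gen

variable {X Y : Type*} [MeasurableSpace X] [MeasurableSpace Y] {μ : Measure X} {ν : Measure Y}
variable {L : Set (X × Y)}

/-- the set where the family is close to a given sequence -/
def nearSet (ξ : ℕ → Lp ℂ 2 μ) (p : ℕ → ℂ) (ε : ℝ) : Set X :=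
  {x | ∑' n, ‖ξ n x - p n‖ₑ ^ 2 ≤ ENNReal.ofReal (ε ^ 2)}

lemma measurableSet_near (ξ : ℕ → Lp ℂ 2 μ) (p : ℕ → ℂ) (ε : ℝ) :
    MeasurableSet (nearSet ξ p ε) := by
  refine measurableSet_le (Measurable.ennreal_tsum fun n => ?_) measurable_const
  exact (((Lp.stronglyMeasurable (ξ n)).measurable.sub_const (p n)).enorm).pow_const 2

lemma tsum_of_enorm {ι E : Type*} [NormedAddCommGroup E] (v : ι → E) {C : ℝ} (hC : 0 ≤ C)
    (h : ∑' n, ‖v n‖ₑ ^ 2 ≤ ENNReal.ofReal C) : SqS v ∧ ∑' n, ‖v n‖ ^ 2 ≤ C := by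
  have h1 : SqS v := (sqS_iff_enorm v).2 (h.trans_lt ENNReal.ofReal_lt_top).ne
  refine ⟨h1, ?_⟩
  have e : ∑' n, ‖v n‖ₑ ^ 2 = ENNReal.ofReal (∑' n, ‖v n‖ ^ 2) := by
    rw [ENNReal.ofReal_tsum_of_nonneg (fun n => by positivity) h1]
    exact tsum_congr fun n => enorm_sq_eq_ofReal _
  rw [e] at h
  exact (ENNReal.ofReal_le_ofReal_iff hC).1 h

/-- approximate families -/
lemma near_bound (ξ : ℕ → Lp ℂ 2 μ) (p : ℕ → ℂ) {ε : ℝ} (hε : 0 ≤ ε) {φ : X → ℂ}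
    {f : Lp ℂ 2 μ} (hφ : AEStronglyMeasurable φ μ) {C : ℝ} (hC : ∀ᵐ x ∂μ, ‖φ x‖ ≤ C)
    (hf : f =ᵐ[μ] φ) (hα : ∀ x, x ∉ nearSet ξ p ε → φ x = 0) :
    (SqS fun n => mulOp φ hφ C hC (ξ n) - p n • f) ∧
      ∑' n, ‖mulOp φ hφ C hC (ξ n) - p n • f‖ ^ 2 ≤ (ε * ‖f‖) ^ 2 := by
  refine tsum_of_enorm _ (by positivity) ?_
  simp only [lp_enorm_sq]
  have e : ∀ n, ∫⁻ x, ‖(mulOp φ hφ C hC (ξ n) - p n • f : Lp ℂ 2 μ) x‖ₑ ^ 2 ∂μ =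
      ∫⁻ x, ‖φ x‖ₑ ^ 2 * ‖ξ n x - p n‖ₑ ^ 2 ∂μ := by
    intro n
    refine lintegral_congr_ae ?_
    filter_upwards [Lp.coeFn_sub (mulOp φ hφ C hC (ξ n)) (p n • f), mulOp_coe φ hφ C hC (ξ n),
      Lp.coeFn_smul (p n) f, hf] with x h1 h2 h3 h4
    rw [h1, Pi.sub_apply, h2, h3, Pi.smul_apply, h4, smul_eq_mul, mul_comm (p n), ← mul_sub,
      enorm_mul, mul_pow]
  simp only [e]
  have hm : ∀ n, AEMeasurable (fun x => ‖φ x‖ₑ ^ 2 * ‖ξ n x - p n‖ₑ ^ 2) μ := fun n =>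
    (hφ.enorm.pow_const 2).mul
    (((Lp.aestronglyMeasurable (ξ n)).sub aestronglyMeasurable_const).enorm.pow_const 2)
  rw [← lintegral_tsum hm]
  have e2 : ENNReal.ofReal ((ε * ‖f‖) ^ 2) = ∫⁻ x, ‖φ x‖ₑ ^ 2 * ENNReal.ofReal (ε ^ 2) ∂μ := by
    rw [lintegral_mul_const' _ _ ENNReal.ofReal_ne_top, mul_pow, ENNReal.ofReal_mul (by positivity),
      ← enorm_sq_eq_ofReal, lp_enorm_sq, mul_comm]
    congr 1
    refine lintegral_congr_ae ?_
    filter_upwards [hf] with x hx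
    rw [hx]
  rw [e2]
  refine lintegral_mono fun x => ?_
  dsimp only
  rw [ENNReal.tsum_mul_left]
  by_cases hx : x ∈ nearSet ξ p ε
  · gcongr; exact hx
  · rw [hα x hx]; simp

/-- indicator operator -/
def chi (μ : Measure X) (α : Set X) (hα : MeasurableSet α) : Lp ℂ 2 μ →L[ℂ] Lp ℂ 2 μ :=
  mulOp (α.indicator fun _ => (1 : ℂ)) (aestronglyMeasurable_const.indicator hα) 1
    (Eventually.of_forall fun x => by
      by_cases h : x ∈ α <;> simp [h])

lemma chi_coe (α : Set X) (hα : MeasurableSet α) (f : Lp ℂ 2 μ) :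
    chi μ α hα f =ᵐ[μ] α.indicator f := by
  filter_upwards [mulOp_coe (μ := μ) (α.indicator fun _ => (1 : ℂ))
    (aestronglyMeasurable_const.indicator hα) 1
    (Eventually.of_forall fun x => by by_cases h : x ∈ α <;> simp [h]) f] with x hx
  unfold chi
  rw [hx]
  by_cases h : x ∈ α
  · rw [indicator_of_mem h, indicator_of_mem h, one_mul]
  · rw [indicator_of_notMem h, indicator_of_notMem h, zero_mul]

lemma chi_norm_le (α : Set X) (hα : MeasurableSet α) (f : Lp ℂ 2 μ) : ‖chi μ α hα f‖ ≤ ‖f‖ := by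
  refine Lp.norm_le_norm_of_ae_le ?_
  filter_upwards [chi_coe α hα f] with x hx
  rw [hx]
  exact norm_indicator_le_norm_self _ _

lemma chi_eq (α : Set X) (hα : MeasurableSet α) (f : Lp ℂ 2 μ) (hf : ∀ᵐ x ∂μ, x ∉ α → f x = 0) :
    chi μ α hα f = f := by
  apply Lp.ext
  filter_upwards [chi_coe α hα f, hf] with x h1 h2
  rw [h1]
  by_cases h : x ∈ α
  · rw [indicator_of_mem h]
  · rw [indicator_of_notMem h, h2 h]

lemma chi_idem (α : Set X) (hα : MeasurableSet α) (f : Lp ℂ 2 μ) :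
    chi μ α hα (chi μ α hα f) = chi μ α hα f := by
  refine chi_eq _ _ _ ?_
  filter_upwards [chi_coe α hα f] with x h1 h
  rw [h1, indicator_of_notMem h]

lemma isMultOp_chi (α : Set X) (hα : MeasurableSet α) : IsMultOp μ (chi μ α hα) :=
  isMultOp_mulOp _ _ _ _

lemma chi_symm (α : Set X) (hα : MeasurableSet α) (f g : Lp ℂ 2 μ) :
    ⟪g, chi μ α hα f⟫ = ⟪chi μ α hα g, f⟫ := by
  rw [L2.inner_def, L2.inner_def]
  refine integral_congr_ae ?_
  filter_upwards [chi_coe α hα f, chi_coe α hα g] with x h1 h2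
  rw [h1, h2]
  by_cases h : x ∈ α
  · rw [indicator_of_mem h, indicator_of_mem h]
  · rw [indicator_of_notMem h, indicator_of_notMem h, inner_zero_left, inner_zero_right]

lemma isMultOp_adjoint {A : Lp ℂ 2 μ →L[ℂ] Lp ℂ 2 μ} (h : IsMultOp μ A) :
    IsMultOp μ (ContinuousLinearMap.adjoint A) := by
  obtain ⟨φ, hφ, ⟨C, hC⟩, hA⟩ := h
  refine ⟨fun x => conj (φ x), RCLike.continuous_conj.comp_aestronglyMeasurable hφ, ⟨C, ?_⟩,
    adjoint_mult hφ hC hA⟩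
  filter_upwards [hC] with x hx; rwa [RCLike.norm_conj]

end P5
end OpSynth

namespace OpSynth

section P6
open Filter
open scoped ENNReal ComplexConjugate

abbrev l2s := lp (fun _ : ℕ => ℂ) 2

lemma l2s_separable : TopologicalSpace.SeparableSpace l2s := by
  rw [← TopologicalSpace.isSeparable_univ_iff]
  have h1 : TopologicalSpace.IsSeparable (range fun i : ℕ => (lp.single 2 i (1 : ℂ) : l2s)) :=
    (countable_range _).isSeparable
  have h2 := (h1.span (R := ℂ)).closure
  refine h2.mono fun f _ => ?_
  have h := lp.hasSum_single (by norm_num) f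
  refine mem_closure_of_tendsto h (Eventually.of_forall fun s => ?_)
  refine Submodule.sum_mem _ fun i _ => ?_
  have : (lp.single 2 i (f i) : l2s) = f i • lp.single 2 i (1 : ℂ) := by
    rw [← lp.single_smul, smul_eq_mul, mul_one]
  rw [this]
  exact Submodule.smul_mem _ _ (Submodule.subset_span ⟨i, rfl⟩)

lemma l2s_sq (v : l2s) : SqS (fun n => v n) ∧ ∑' n, ‖v n‖ ^ 2 = ‖v‖ ^ 2 := by
  have h := lp.hasSum_norm (p := 2) (by norm_num) v
  simp only [ENNReal.toReal_ofNat, Real.rpow_ofNat] at h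
  exact ⟨h.summable, h.tsum_eq⟩

def l2mk (F : ℕ → ℂ) (hF : SqS F) : l2s := ⟨F, by
  refine memℓp_gen ?_
  have h : Summable fun n => ‖F n‖ ^ 2 := hF
  simpa using h⟩

lemma l2s_cover : ∃ D : ℕ → ℕ → ℂ, (∀ i, SqS (D i)) ∧ ∀ F G : ℕ → ℂ, SqS F → SqS G →
    ∑' n, F n * conj (G n) ≠ 0 → ∃ i j k : ℕ,
      ∑' n, ‖F n - D i n‖ ^ 2 ≤ (1 / ((k : ℝ) + 1)) ^ 2 ∧
      ∑' n, ‖G n - D j n‖ ^ 2 ≤ (1 / ((k : ℝ) + 1)) ^ 2 ∧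
      1 / ((k : ℝ) + 1) * (√(∑' n, ‖D i n‖ ^ 2) + √(∑' n, ‖D j n‖ ^ 2) + 1 / ((k : ℝ) + 1)) <
        ‖∑' n, D i n * conj (D j n)‖ := by
  haveI := l2s_separable
  let d : ℕ → l2s := TopologicalSpace.denseSeq l2s
  refine ⟨fun i n => d i n, fun i => (l2s_sq (d i)).1, ?_⟩
  intro F G hF hG hne
  let f : l2s := l2mk F hF
  let g : l2s := l2mk G hG
  have hin : ∀ v w : l2s, ⟪w, v⟫ = ∑' n, v n * conj (w n) := by
    intro v w
    rw [lp.inner_eq_tsum]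
    rfl
  have ho : IsOpen {q : (l2s × l2s) × ℝ | q.2 * (‖q.1.1‖ + ‖q.1.2‖ + q.2) < ‖⟪q.1.2, q.1.1⟫‖} := by
    refine isOpen_lt (by fun_prop) ?_
    exact (continuous_fst.snd.inner continuous_fst.fst).norm
  have hm : ((f, g), (0 : ℝ)) ∈ {q : (l2s × l2s) × ℝ | q.2 * (‖q.1.1‖ + ‖q.1.2‖ + q.2) < ‖⟪q.1.2, q.1.1⟫‖} := by
    change 0 * _ < ‖⟪g, f⟫‖
    rw [zero_mul, norm_pos_iff, hin]
    exact hne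
  obtain ⟨r, hr, hball⟩ := Metric.isOpen_iff.1 ho _ hm
  obtain ⟨k, hk⟩ := exists_nat_one_div_lt hr
  have hk0 : (0 : ℝ) < 1 / ((k : ℝ) + 1) := by positivity
  have hd := TopologicalSpace.denseRange_denseSeq l2s
  obtain ⟨i, hi⟩ := hd.exists_dist_lt f hk0
  obtain ⟨j, hj⟩ := hd.exists_dist_lt g hk0
  have hb := hball (show ((d i, d j), (1 / ((k : ℝ) + 1))) ∈ Metric.ball ((f, g), (0 : ℝ)) r by
    rw [Metric.mem_ball, Prod.dist_eq, Prod.dist_eq, max_lt_iff, max_lt_iff]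
    refine ⟨⟨?_, ?_⟩, ?_⟩
    · rw [dist_comm]; exact hi.trans hk
    · rw [dist_comm]; exact hj.trans hk
    · rw [Real.dist_eq, sub_zero, abs_of_pos hk0]; exact hk)
  refine ⟨i, j, k, ?_, ?_, ?_⟩
  · have := (l2s_sq (f - d i)).2
    rw [dist_eq_norm] at hi
    calc ∑' n, ‖F n - d i n‖ ^ 2 = ‖f - d i‖ ^ 2 := this
      _ ≤ _ := by gcongr
  · have := (l2s_sq (g - d j)).2
    rw [dist_eq_norm] at hj
    calc ∑' n, ‖G n - d j n‖ ^ 2 = ‖g - d j‖ ^ 2 := this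
      _ ≤ _ := by gcongr
  · rw [(l2s_sq (d i)).2, (l2s_sq (d j)).2, Real.sqrt_sq (norm_nonneg _),
      Real.sqrt_sq (norm_nonneg _), ← hin]
    exact hb

variable {X Y : Type*} [MeasurableSpace X] [MeasurableSpace Y] {μ : Measure X} {ν : Measure Y}
variable {L : Set (X × Y)}

lemma simple_repr {α : Set X} (hα : MeasurableSet α) (f : Lp.simpleFunc ℂ 2 μ) :
    ∃ φ : X → ℂ, AEStronglyMeasurable φ μ ∧ (∃ C, ∀ᵐ x ∂μ, ‖φ x‖ ≤ C) ∧
      chi μ α hα (f : Lp ℂ 2 μ) =ᵐ[μ] φ ∧ ∀ x ∉ α, φ x = 0 := by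
  refine ⟨α.indicator (Lp.simpleFunc.toSimpleFunc f),
    (Lp.simpleFunc.aestronglyMeasurable f).indicator hα, ?_, ?_, fun x hx => indicator_of_notMem hx _⟩
  · obtain ⟨C, hC⟩ := (Lp.simpleFunc.toSimpleFunc f).exists_forall_norm_le
    exact ⟨C, Eventually.of_forall fun x => (norm_indicator_le_norm_self _ _).trans (hC x)⟩
  · filter_upwards [chi_coe α hα (f : Lp ℂ 2 μ), Lp.simpleFunc.toSimpleFunc_eq_toFun f] with x h1 h2
    rw [h1]
    by_cases h : x ∈ α
    · rw [indicator_of_mem h, indicator_of_mem h, h2]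
    · rw [indicator_of_notMem h, indicator_of_notMem h]

lemma near_zero {U : Set (Lp ℂ 2 μ →L[ℂ] Lp ℂ 2 ν)} (hU : IsMultBimodule μ ν U)
    {ξ : ℕ → Lp ℂ 2 μ} {η : ℕ → Lp ℂ 2 ν}
    (hk : ∀ S ∈ U, ∑' n, ⟪η n, S (ξ n)⟫ = 0) {p q : ℕ → ℂ} (hp : SqS p) (hq : SqS q) {ε : ℝ}
    (hε : 0 < ε) (hgood : ε * (√(∑' n, ‖p n‖ ^ 2) + √(∑' n, ‖q n‖ ^ 2) + ε) <
      ‖∑' n, p n * conj (q n)‖) {S : Lp ℂ 2 μ →L[ℂ] Lp ℂ 2 ν} (hS : S ∈ U) {f : Lp ℂ 2 μ}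
    {g : Lp ℂ 2 ν} (hf : ∀ᵐ x ∂μ, x ∉ nearSet ξ p ε → f x = 0)
    (hg : ∀ᵐ x ∂ν, x ∉ nearSet η q ε → g x = 0) : ⟪g, S f⟫ = 0 := by
  have mα := measurableSet_near ξ p ε
  have mβ := measurableSet_near η q ε
  set A := chi μ _ mα with hA
  set B := chi ν _ mβ with hB
  set T := B ∘L S ∘L A with hT
  have hTU : T ∈ U := hU.2 S hS A B (isMultOp_chi _ _) (isMultOp_chi _ _)
  set P := √(∑' n, ‖p n‖ ^ 2)
  set Q := √(∑' n, ‖q n‖ ^ 2)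
  have hP : ∑' n, ‖p n‖ ^ 2 = P ^ 2 := (Real.sq_sqrt (tsum_nonneg fun n => by positivity)).symm
  have hQ : ∑' n, ‖q n‖ ^ 2 = Q ^ 2 := (Real.sq_sqrt (tsum_nonneg fun n => by positivity)).symm
  set s := ‖∑' n, p n * conj (q n)‖
  set e := ε * (P + Q + ε)
  have hP0 : 0 ≤ P := Real.sqrt_nonneg _
  have hQ0 : 0 ≤ Q := Real.sqrt_nonneg _
  have he0 : 0 < e := by positivity
  have hTin : ∀ f g, ⟪B g, T (A f)⟫ = ⟪g, T f⟫ := by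
    intro f g
    change ⟪B g, B (S (A (A f)))⟫ = ⟪g, B (S (A f))⟫
    rw [hA, chi_idem, ← hA, hB, ← chi_symm, chi_idem]
  have simple : ∀ (f : Lp.simpleFunc ℂ 2 μ) (g : Lp.simpleFunc ℂ 2 ν),
      s * ‖⟪(g : Lp ℂ 2 ν), T (f : Lp ℂ 2 μ)⟫‖ ≤ ‖T‖ * (e * (‖(f : Lp ℂ 2 μ)‖ * ‖(g : Lp ℂ 2 ν)‖)) := by
    intro f g
    obtain ⟨φ, hφ, ⟨C, hC⟩, hφf, hφ0⟩ := simple_repr mα f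
    obtain ⟨ψ, hψ, ⟨D, hD⟩, hψg, hψ0⟩ := simple_repr mβ g
    have n1 := near_bound ξ p hε.le hφ hC hφf hφ0
    have n2 := near_bound η q hε.le hψ hD hψg hψ0
    have h0 : ∑' n, ⟪mulOp ψ hψ D hD (η n), T (mulOp φ hφ C hC (ξ n))⟫ = 0 := by
      rw [← hk _ (hU.2 T hTU (mulOp φ hφ C hC) (ContinuousLinearMap.adjoint (mulOp ψ hψ D hD))
        (isMultOp_mulOp _ _ _ _) (isMultOp_adjoint (isMultOp_mulOp _ _ _ _)))]
      refine tsum_congr fun n => ?_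
      change _ = ⟪η n, ContinuousLinearMap.adjoint (mulOp ψ hψ D hD) (T (mulOp φ hφ C hC (ξ n)))⟫
      rw [ContinuousLinearMap.adjoint_inner_right]
    have := approx_bound T hε.le hP0 hQ0 hp hq hP.le hQ.le n1.1 n2.1 n1.2 n2.2 h0
    rw [← hA, ← hB, hTin] at this
    refine this.trans ?_
    gcongr
    · exact chi_norm_le _ _ _
    · exact chi_norm_le _ _ _
  have all : ∀ (f : Lp ℂ 2 μ) (g : Lp ℂ 2 ν), s * ‖⟪g, T f⟫‖ ≤ ‖T‖ * (e * (‖f‖ * ‖g‖)) := by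
    intro f g
    refine (Lp.simpleFunc.denseRange (E := ℂ) (μ := μ) (p := 2) (by norm_num)).induction_on
      (p := fun f => s * ‖⟪g, T f⟫‖ ≤ ‖T‖ * (e * (‖f‖ * ‖g‖))) f ?_ ?_
    · refine isClosed_le ?_ (by fun_prop)
      exact continuous_const.mul (continuous_const.inner T.continuous).norm
    intro f
    refine (Lp.simpleFunc.denseRange (E := ℂ) (μ := ν) (p := 2) (by norm_num)).induction_on
      (p := fun g => s * ‖⟪g, T (f : Lp ℂ 2 μ)⟫‖ ≤ ‖T‖ * (e * (‖(f : Lp ℂ 2 μ)‖ * ‖g‖))) g ?_ ?_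
    · refine isClosed_le ?_ (by fun_prop)
      exact continuous_const.mul (continuous_id.inner continuous_const).norm
    intro g
    exact simple f g
  have hT0 : T = 0 := by
    have hs : 0 < s := he0.trans hgood
    have hb : ‖T‖ ≤ (e / s) * ‖T‖ := by
      refine T.opNorm_le_bound (by positivity) fun f => ?_
      by_cases h0 : T f = 0
      · rw [h0, norm_zero]; positivity
      have a := all f (T f)
      have hpos := norm_pos_iff.2 h0
      have b : ‖⟪T f, T f⟫‖ = ‖T f‖ * ‖T f‖ := by
        have h : ⟪T f, T f⟫ = ((‖T f‖ : ℝ) : ℂ) ^ 2 := inner_self_eq_norm_sq_to_K _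
        rw [h, norm_pow, Complex.norm_real, norm_norm, sq]
      rw [b] at a
      have a' : (s * ‖T f‖) * ‖T f‖ ≤ (‖T‖ * e * ‖f‖) * ‖T f‖ := by linarith
      have := le_of_mul_le_mul_right a' hpos
      rw [div_mul_eq_mul_div, div_mul_eq_mul_div, le_div_iff₀ hs]
      linarith
    by_contra hne
    have hTn := norm_pos_iff.2 hne
    have : e / s < 1 := (div_lt_one hs).2 hgood
    nlinarith
  have h1 : ⟪g, T f⟫ = ⟪g, S f⟫ := by
    change ⟪g, B (S (A f))⟫ = _
    rw [hB, chi_symm, chi_eq _ _ _ hg, hA, chi_eq _ _ _ hf]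
  rw [← h1, hT0]; simp

lemma exists_supp [SigmaFinite μ] {α : Set X} (hα : MeasurableSet α) :
    ∃ f : Lp ℂ 2 μ, (∀ᵐ x ∂μ, x ∉ α → f x = 0) ∧ ∀ᵐ x ∂μ, x ∈ α → f x ≠ 0 := by
  obtain ⟨w, hw, hm, hi⟩ := exists_pos_lintegral_lt_of_sigmaFinite μ (ε := 1) one_ne_zero
  let φ : X → ℂ := α.indicator fun x => ((√(w x : ℝ) : ℝ) : ℂ)
  have hφm : Measurable φ := Measurable.indicator (by fun_prop) hα
  have hφ : MemLp φ 2 μ := by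
    refine ⟨hφm.aestronglyMeasurable, ?_⟩
    rw [eLpNorm_lt_top_iff_lintegral_rpow_enorm_lt_top (by norm_num) (by norm_num)]
    refine lt_of_le_of_lt (lintegral_mono fun x => ?_) (hi.trans ENNReal.one_lt_top)
    simp only [ENNReal.toReal_ofNat, ENNReal.rpow_ofNat]
    by_cases h : x ∈ α
    · simp only [φ]
      rw [indicator_of_mem h, enorm_sq_eq_ofReal, Complex.norm_real, Real.norm_eq_abs, sq_abs,
        Real.sq_sqrt (NNReal.coe_nonneg (w x)), ENNReal.ofReal_coe_nnreal]
    · simp only [φ]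
      rw [indicator_of_notMem h]; simp
  refine ⟨hφ.toLp φ, ?_, ?_⟩
  · filter_upwards [hφ.coeFn_toLp] with x hx h
    rw [hx]; exact indicator_of_notMem h _
  · filter_upwards [hφ.coeFn_toLp] with x hx h
    rw [hx]; simp only [φ]; rw [indicator_of_mem h]
    have : 0 < √(w x : ℝ) := Real.sqrt_pos.2 (hw x)
    exact_mod_cast this.ne'

lemma lemma_A [SigmaFinite μ] [SigmaFinite ν] {U : Set (Lp ℂ 2 μ →L[ℂ] Lp ℂ 2 ν)}
    (hU : IsMultBimodule μ ν U) (hR : RefHull U = Mmax μ ν L)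
    {ξ : ℕ → Lp ℂ 2 μ} {η : ℕ → Lp ℂ 2 ν} (hξ : SqS ξ) (hη : SqS η)
    (hk : ∀ S ∈ U, ∑' n, ⟪η n, S (ξ n)⟫ = 0) : KerRep μ ν L ξ η 0 := by
  obtain ⟨D, hD, hcov⟩ := l2s_cover
  have hnull : ∀ i j k : ℕ, 1 / ((k : ℝ) + 1) * (√(∑' n, ‖D i n‖ ^ 2) + √(∑' n, ‖D j n‖ ^ 2) +
      1 / ((k : ℝ) + 1)) < ‖∑' n, D i n * conj (D j n)‖ →
      ∀ᶠ r in (ae μ ×ˢ ae ν), r ∉ ((nearSet ξ (D i) (1 / ((k : ℝ) + 1))) ×ˢ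
        (nearSet η (D j) (1 / ((k : ℝ) + 1)))) ∩ L := by
    intro i j k hg
    obtain ⟨f, hf0, hf1⟩ := exists_supp (μ := μ) (measurableSet_near ξ (D i) (1 / ((k : ℝ) + 1)))
    obtain ⟨g, hg0, hg1⟩ := exists_supp (μ := ν) (measurableSet_near η (D j) (1 / ((k : ℝ) + 1)))
    have hz : ∀ S ∈ U, ⟪g, S f⟫ = 0 := fun S hS =>
      near_zero hU hk (hD i) (hD j) (by positivity) hg hS hf0 hg0
    by_contra hn
    have : ¬ ∀ᶠ p in (ae μ ×ˢ ae ν), p ∈ L → elemK f g p = 0 := by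
      intro h
      apply hn
      filter_upwards [h, hf1.prod_inl _, hg1.prod_inr _] with r h1 h2 h3
      rintro ⟨⟨ha, hb⟩, hL⟩
      have := h1 hL
      simp only [elemK, mul_eq_zero, map_eq_zero] at this
      rcases this with h | h
      · exact h2 ha h
      · exact h3 hb h
    obtain ⟨R, hR1, hR2⟩ := exists_hb f g this
    have hRm : R ∈ RefHull U := by rw [hR]; exact Vk_sub_Mmax hR2
    exact hR1 (inner_zero_of_ref hRm hz)
  have hall : ∀ᶠ r in (ae μ ×ˢ ae ν), ∀ t : ℕ × ℕ × ℕ,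
      1 / ((t.2.2 : ℝ) + 1) * (√(∑' n, ‖D t.1 n‖ ^ 2) + √(∑' n, ‖D t.2.1 n‖ ^ 2) +
      1 / ((t.2.2 : ℝ) + 1)) < ‖∑' n, D t.1 n * conj (D t.2.1 n)‖ →
      r ∉ ((nearSet ξ (D t.1) (1 / ((t.2.2 : ℝ) + 1))) ×ˢ
        (nearSet η (D t.2.1) (1 / ((t.2.2 : ℝ) + 1)))) ∩ L := by
    refine mae_all fun t => ?_
    by_cases h : 1 / ((t.2.2 : ℝ) + 1) * (√(∑' n, ‖D t.1 n‖ ^ 2) + √(∑' n, ‖D t.2.1 n‖ ^ 2) +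
      1 / ((t.2.2 : ℝ) + 1)) < ‖∑' n, D t.1 n * conj (D t.2.1 n)‖
    · filter_upwards [hnull t.1 t.2.1 t.2.2 h] with r hr _
      exact hr
    · exact Eventually.of_forall fun r h' => absurd h' h
  have hsub : ∀ {a b : ℕ → ℂ}, SqS a → SqS b → ∀ {c : ℝ}, ∑' n, ‖a n - b n‖ ^ 2 ≤ c →
      ∑' n, ‖a n - b n‖ₑ ^ 2 ≤ ENNReal.ofReal c := by
    intro a b ha hb c h
    have hs : SqS fun n => a n - b n := (l2s_sq (l2mk a ha - l2mk b hb)).1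
    calc ∑' n, ‖a n - b n‖ₑ ^ 2 = ENNReal.ofReal (∑' n, ‖a n - b n‖ ^ 2) := by
          rw [ENNReal.ofReal_tsum_of_nonneg (fun n => by positivity) hs]
          exact tsum_congr fun n => enorm_sq_eq_ofReal _
      _ ≤ _ := ENNReal.ofReal_le_ofReal h
  filter_upwards [hall, (ae_sqS hξ).prod_inl _, (ae_sqS hη).prod_inr _] with r hr h1 h2 hL
  have hs := sqS_mul h1 h2
  have : ∑' n, ξ n r.1 * conj (η n r.2) = 0 := by
    by_contra hne
    obtain ⟨i, j, k, c1, c2, c3⟩ := hcov _ _ h1 h2 hne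
    exact hr (i, j, k) c3 ⟨⟨hsub h1 (hD i) c1, hsub h2 (hD j) c2⟩, hL⟩
  have e := hs.hasSum
  rw [this] at e
  exact e

end P6
end OpSynth

namespace OpSynth

section P7
open Filter
open scoped ENNReal ComplexConjugate

variable {H K T : Type*}
  [NormedAddCommGroup H] [InnerProductSpace ℂ H] [CompleteSpace H]
  [NormedAddCommGroup K] [InnerProductSpace ℂ K] [CompleteSpace K]
  [NormedAddCommGroup T] [InnerProductSpace ℂ T] [CompleteSpace T]
  {t : H → K → T}

lemma te_inner (ht : IsTensorEmbedding t) (x x' : H) (y y' : K) :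
    ⟪t x y, t x' y'⟫ = ⟪x, x'⟫ * ⟪y, y'⟫ := ht.2.2.2.2.1 x x' y y'

lemma te_norm (ht : IsTensorEmbedding t) (x : H) (y : K) : ‖t x y‖ = ‖x‖ * ‖y‖ := by
  have h := te_inner ht x x y y
  rw [inner_self_eq_norm_sq_to_K, inner_self_eq_norm_sq_to_K, inner_self_eq_norm_sq_to_K] at h
  have h2 : ‖t x y‖ ^ 2 = ‖x‖ ^ 2 * ‖y‖ ^ 2 := by exact_mod_cast h
  rw [← mul_pow] at h2
  exact (pow_left_inj₀ (norm_nonneg _) (by positivity) two_ne_zero).1 h2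

lemma te_swap (ht : IsTensorEmbedding t) : IsTensorEmbedding (fun y x => t x y) := by
  obtain ⟨h1, h2, h3, h4, h5, h6⟩ := ht
  refine ⟨fun x x' y => h2 y x x', fun x y y' => h1 y y' x, fun c x y => h4 c y x,
    fun c x y => h3 c y x, fun x x' y y' => by rw [h5, mul_comm], ?_⟩
  rw [← h6]
  congr 2
  ext z
  exact ⟨fun ⟨x, y, h⟩ => ⟨y, x, h⟩, fun ⟨x, y, h⟩ => ⟨y, x, h⟩⟩

def sl (ht : IsTensorEmbedding t) (y : K) : H →L[ℂ] T :=
  LinearMap.mkContinuous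
    { toFun := fun x => t x y
      map_add' := fun a b => ht.1 a b y
      map_smul' := fun c a => ht.2.2.1 c a y } ‖y‖ (fun x => by
        change ‖t x y‖ ≤ _
        rw [te_norm ht, mul_comm])

lemma sl_apply (ht : IsTensorEmbedding t) (y : K) (x : H) : sl ht y x = t x y := rfl

def sla (ht : IsTensorEmbedding t) (y : K) : T →L[ℂ] H := ContinuousLinearMap.adjoint (sl ht y)

lemma sla_inner (ht : IsTensorEmbedding t) (y : K) (x : H) (z : T) :
    ⟪x, sla ht y z⟫ = ⟪t x y, z⟫ := by
  rw [sla, ContinuousLinearMap.adjoint_inner_right, sl_apply]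

lemma sla_apply (ht : IsTensorEmbedding t) (y' : K) (x : H) (y : K) :
    sla ht y' (t x y) = ⟪y', y⟫ • x := by
  refine ext_inner_left ℂ fun v => ?_
  rw [sla_inner, te_inner ht, inner_smul_right, mul_comm]

/-- two operators agreeing on elementary tensors agree -/
lemma te_ext (ht : IsTensorEmbedding t) {E : Type*} [NormedAddCommGroup E] [InnerProductSpace ℂ E]
    {A B : T →L[ℂ] E} (h : ∀ x y, A (t x y) = B (t x y)) : A = B := by
  have h6 := ht.2.2.2.2.2
  refine ContinuousLinearMap.ext_on (s := {z | ∃ x y, z = t x y}) ?_ ?_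
  · rw [← Submodule.dense_iff_topologicalClosure_eq_top] at h6
    exact h6
  · rintro z ⟨x, y, rfl⟩
    exact h x y

def slI (ht : IsTensorEmbedding t) {ι : Type*} (e : HilbertBasis ι ℂ K) (j : ι) : H →ₗᵢ[ℂ] T :=
  { toLinearMap := (sl ht (e j)).toLinearMap
    norm_map' := fun x => by
      change ‖t x (e j)‖ = _
      rw [te_norm ht, e.orthonormal.1 j, mul_one] }

lemma slI_apply (ht : IsTensorEmbedding t) {ι : Type*} (e : HilbertBasis ι ℂ K) (j : ι) (x : H) :
    slI ht e j x = t x (e j) := rfl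

lemma slI_orth (ht : IsTensorEmbedding t) {ι : Type*} (e : HilbertBasis ι ℂ K) :
    OrthogonalFamily ℂ (fun _ : ι => H) (slI ht e) := by
  intro i j hij v w
  rw [slI_apply, slI_apply, te_inner ht, e.orthonormal.2 hij, mul_zero]

lemma slI_sum (ht : IsTensorEmbedding t) {ι : Type*} (e : HilbertBasis ι ℂ K) :
    IsHilbertSum ℂ (fun _ : ι => H) (slI ht e) := by
  refine IsHilbertSum.mk (slI_orth ht e) ?_
  rw [← ht.2.2.2.2.2]
  refine Submodule.topologicalClosure_minimal _ ?_ (Submodule.isClosed_topologicalClosure _)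
  rw [Submodule.span_le]
  rintro z ⟨x, y, rfl⟩
  have h := (e.hasSum_repr y).mapL (sl (te_swap ht) x)
  refine mem_closure_of_tendsto h (Eventually.of_forall fun s => ?_)
  refine Submodule.sum_mem _ fun i _ => ?_
  rw [ContinuousLinearMap.map_smul]
  refine Submodule.smul_mem _ _ ?_
  exact Submodule.mem_iSup_of_mem i ⟨x, rfl⟩

lemma slI_equiv (ht : IsTensorEmbedding t) {ι : Type*} (e : HilbertBasis ι ℂ K) (z : T) (j : ι) :
    (slI_sum ht e).linearIsometryEquiv z j = sla ht (e j) z := by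
  classical
  refine ext_inner_left ℂ fun v => ?_
  rw [sla_inner]
  have h := lp.inner_single_left (𝕜 := ℂ) (G := fun _ : ι => H) j v ((slI_sum ht e).linearIsometryEquiv z)
  rw [← h, ← LinearIsometryEquiv.inner_map_map (slI_sum ht e).linearIsometryEquiv.symm,
    IsHilbertSum.linearIsometryEquiv_symm_apply_single, LinearIsometryEquiv.symm_apply_apply, slI_apply]

lemma sl_hasSum (ht : IsTensorEmbedding t) {ι : Type*} (e : HilbertBasis ι ℂ K) (z : T) :
    HasSum (fun j => sl ht (e j) (sla ht (e j) z)) z := by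
  have h := (slI_sum ht e).hasSum_linearIsometryEquiv_symm ((slI_sum ht e).linearIsometryEquiv z)
  rw [LinearIsometryEquiv.symm_apply_apply] at h
  simp only [slI_equiv] at h
  exact h

lemma sla_hasSum_inner (ht : IsTensorEmbedding t) {ι : Type*} (e : HilbertBasis ι ℂ K) (z w : T) :
    HasSum (fun j => ⟪sla ht (e j) z, sla ht (e j) w⟫) ⟪z, w⟫ := by
  have h := lp.hasSum_inner (𝕜 := ℂ) ((slI_sum ht e).linearIsometryEquiv z)
    ((slI_sum ht e).linearIsometryEquiv w)
  rw [LinearIsometryEquiv.inner_map_map] at h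
  simp only [slI_equiv] at h
  exact h

lemma sla_hasSum_sq (ht : IsTensorEmbedding t) {ι : Type*} (e : HilbertBasis ι ℂ K) (z : T) :
    HasSum (fun j => ‖sla ht (e j) z‖ ^ 2) (‖z‖ ^ 2) := by
  have h := lp.hasSum_norm (p := 2) (by norm_num) ((slI_sum ht e).linearIsometryEquiv z)
  simp only [ENNReal.toReal_ofNat, Real.rpow_ofNat] at h
  rw [LinearIsometryEquiv.norm_map] at h
  simp only [slI_equiv] at h
  exact h

def PF (ht : IsTensorEmbedding t) {ι : Type*} (e : HilbertBasis ι ℂ K) (F : Finset ι) : T →L[ℂ] T :=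
  ∑ j ∈ F, sl ht (e j) ∘L sla ht (e j)

lemma PF_apply (ht : IsTensorEmbedding t) {ι : Type*} (e : HilbertBasis ι ℂ K) (F : Finset ι) (z : T) :
    PF ht e F z = ∑ j ∈ F, sl ht (e j) (sla ht (e j) z) := by
  rw [PF, ContinuousLinearMap.sum_apply]; rfl

lemma PF_norm (ht : IsTensorEmbedding t) {ι : Type*} (e : HilbertBasis ι ℂ K) (F : Finset ι) (z : T) :
    ‖PF ht e F z‖ ≤ ‖z‖ := by
  have h := (slI_orth ht e).norm_sum (fun j => sla ht (e j) z) F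
  have h2 : ‖PF ht e F z‖ ^ 2 ≤ ‖z‖ ^ 2 := by
    rw [PF_apply]
    refine (le_of_eq h).trans ?_
    exact sum_le_hasSum _ (fun j _ => by positivity) (sla_hasSum_sq ht e z)
  exact (sq_le_sq₀ (norm_nonneg _) (norm_nonneg _)).1 h2

lemma PF_tendsto (ht : IsTensorEmbedding t) {ι : Type*} (e : HilbertBasis ι ℂ K) (z : T) :
    Tendsto (fun F => PF ht e F z) atTop (nhds z) := by
  have h := sl_hasSum ht e z
  simp only [PF_apply]
  exact h

variable {H' K' T' : Type*}
  [NormedAddCommGroup H'] [InnerProductSpace ℂ H'] [CompleteSpace H']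
  [NormedAddCommGroup K'] [InnerProductSpace ℂ K'] [CompleteSpace K']
  [NormedAddCommGroup T'] [InnerProductSpace ℂ T'] [CompleteSpace T']
  {t' : H' → K' → T'}

lemma tendsto_sigmaWeak {γ : Type*} {l : Filter γ} {A : γ → (T →L[ℂ] T')} {B : T →L[ℂ] T'}
    (h : ∀ (ξ : ℕ → T) (η : ℕ → T'), SqS ξ → SqS η →
      Tendsto (fun c => ∑' n, ⟪η n, A c (ξ n)⟫) l (nhds (∑' n, ⟪η n, B (ξ n)⟫))) :
    Tendsto A l (@nhds _ (sigmaWeak T T') B) := by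
  unfold sigmaWeak
  simp only [nhds_iInf, nhds_induced, tendsto_iInf, tendsto_comap_iff]
  intro ξ η h1 h2
  exact h ξ η h1 h2

lemma mem_wTensor_of_slices (ht : IsTensorEmbedding t) (ht' : IsTensorEmbedding t')
    {V : Set (H →L[ℂ] H')} {A : T →L[ℂ] T'}
    (hA : ∀ y y', sla ht' y' ∘L A ∘L sl ht y ∈ V) : A ∈ wTensor t t' V univ := by
  obtain ⟨w, e, -⟩ := exists_hilbertBasis ℂ K
  obtain ⟨w', e', -⟩ := exists_hilbertBasis ℂ K'
  have key : Tendsto (fun q : Finset w × Finset w' => PF ht' e' q.2 ∘L A ∘L PF ht e q.1) (atTop ×ˢ atTop)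
      (@nhds _ (sigmaWeak T T') A) := by
    refine tendsto_sigmaWeak fun ξ η h1 h2 => ?_
    refine tendsto_tsum_of_dominated_convergence (bound := fun n => ‖A‖ * (‖η n‖ * ‖ξ n‖))
      ((h1.norm_pair h2).mul_left _) (fun n => ?_) (Eventually.of_forall fun q n => ?_)
    · have a1 : Tendsto (fun q : Finset w × Finset w' => A (PF ht e q.1 (ξ n))) (atTop ×ˢ atTop) (nhds (A (ξ n))) :=
        (A.continuous.tendsto _).comp ((PF_tendsto ht e (ξ n)).comp tendsto_fst)
      have a2 : Tendsto (fun q : Finset w × Finset w' => PF ht' e' q.2 (A (ξ n))) (atTop ×ˢ atTop) (nhds (A (ξ n))) :=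
        (PF_tendsto ht' e' _).comp tendsto_snd
      have a3 : Tendsto (fun q : Finset w × Finset w' => PF ht' e' q.2 (A (PF ht e q.1 (ξ n)))) (atTop ×ˢ atTop)
          (nhds (A (ξ n))) := by
        rw [tendsto_iff_norm_sub_tendsto_zero] at a1 a2 ⊢
        have a4 := a1.add a2
        rw [add_zero] at a4
        refine squeeze_zero (fun q => norm_nonneg _) (fun q => ?_) a4
        have : PF ht' e' q.2 (A (PF ht e q.1 (ξ n))) - A (ξ n) =
          PF ht' e' q.2 (A (PF ht e q.1 (ξ n)) - A (ξ n)) + (PF ht' e' q.2 (A (ξ n)) - A (ξ n)) := by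
          rw [map_sub]; abel
        rw [this]
        refine (norm_add_le _ _).trans ?_
        gcongr
        exact PF_norm _ _ _ _
      exact tendsto_const_nhds.inner a3
    · calc ‖⟪η n, PF ht' e' q.2 (A (PF ht e q.1 (ξ n)))⟫‖ ≤ ‖η n‖ * ‖PF ht' e' q.2 (A (PF ht e q.1 (ξ n)))‖ :=
          norm_inner_le_norm _ _
        _ ≤ ‖η n‖ * (‖A‖ * ‖ξ n‖) := by
          gcongr
          refine (PF_norm _ _ _ _).trans ((A.le_opNorm _).trans ?_)
          gcongr
          exact PF_norm _ _ _ _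
        _ = _ := by ring
  unfold wTensor wkClosure
  letI := sigmaWeak T T'
  refine mem_closure_of_tendsto key (Eventually.of_forall fun q => ?_)
  have e1 : PF ht' e' q.2 ∘L A ∘L PF ht e q.1 = ∑ i ∈ q.2, ∑ j ∈ q.1,
      sl ht' (e' i) ∘L (sla ht' (e' i) ∘L A ∘L sl ht (e j)) ∘L sla ht (e j) := by
    ext z
    simp only [ContinuousLinearMap.comp_apply, PF_apply, ContinuousLinearMap.sum_apply, map_sum]
    exact Finset.sum_comm
  rw [e1]
  refine Submodule.sum_mem _ fun i _ => Submodule.sum_mem _ fun j _ => Submodule.subset_span ?_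
  refine ⟨_, hA (e j) (e' i), (innerSL ℂ (e j)).smulRight (e' i), mem_univ _, fun x y => ?_⟩
  set S := sla ht' (e' i) ∘L A ∘L sl ht (e j)
  change sl ht' (e' i) (S (sla ht (e j) (t x y))) = t' (S x) (⟪e j, y⟫ • e' i)
  rw [sla_apply, map_smul, map_smul, sl_apply, ht'.2.2.2.1]

lemma wTensor_swap (V : Set (H →L[ℂ] H')) (U : Set (K →L[ℂ] K')) :
    wTensor (fun y x => t x y) (fun y x => t' x y) U V = wTensor t t' V U := by
  unfold wTensor
  congr 3
  ext W
  constructor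
  · rintro ⟨S, hS, R, hR, h⟩
    exact ⟨R, hR, S, hS, fun x y => h y x⟩
  · rintro ⟨S, hS, R, hR, h⟩
    exact ⟨R, hR, S, hS, fun x y => h y x⟩

end P7
end OpSynth

namespace OpSynth

section P8
open Filter
open scoped ENNReal ComplexConjugate

variable {X Y : Type*} [MeasurableSpace X] [MeasurableSpace Y] {μ : Measure X} {ν : Measure Y}
  [SigmaFinite μ] [SigmaFinite ν]

lemma tp_memLp (x : Lp ℂ 2 μ) (y : Lp ℂ 2 ν) :
    MemLp (fun p : X × Y => x p.1 * y p.2) 2 (μ.prod ν) := by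
  refine ⟨(Lp.aestronglyMeasurable x).comp_fst.mul (Lp.aestronglyMeasurable y).comp_snd, ?_⟩
  rw [eLpNorm_lt_top_iff_lintegral_rpow_enorm_lt_top (by norm_num) (by norm_num)]
  simp only [ENNReal.toReal_ofNat, ENNReal.rpow_ofNat, enorm_mul, mul_pow]
  rw [lintegral_prod_mul ((Lp.aestronglyMeasurable x).enorm.pow_const 2)
    ((Lp.aestronglyMeasurable y).enorm.pow_const 2), ← lp_enorm_sq, ← lp_enorm_sq]
  exact ENNReal.mul_lt_top (ENNReal.pow_lt_top enorm_lt_top) (ENNReal.pow_lt_top enorm_lt_top)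

def tp (x : Lp ℂ 2 μ) (y : Lp ℂ 2 ν) : Lp ℂ 2 (μ.prod ν) := (tp_memLp x y).toLp _

lemma tp_coe (x : Lp ℂ 2 μ) (y : Lp ℂ 2 ν) :
    tp x y =ᵐ[μ.prod ν] fun p => x p.1 * y p.2 := (tp_memLp x y).coeFn_toLp

lemma ae_fst {P : X → Prop} (h : ∀ᵐ x ∂μ, P x) : ∀ᵐ p ∂(μ.prod ν), P p.1 :=
  Measure.quasiMeasurePreserving_fst.ae h

lemma ae_snd {P : Y → Prop} (h : ∀ᵐ x ∂ν, P x) : ∀ᵐ p ∂(μ.prod ν), P p.2 :=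
  Measure.quasiMeasurePreserving_snd.ae h

lemma tp_inner (x x' : Lp ℂ 2 μ) (y y' : Lp ℂ 2 ν) :
    ⟪tp x y, tp x' y'⟫ = ⟪x, x'⟫ * ⟪y, y'⟫ := by
  rw [L2.inner_def, L2.inner_def, L2.inner_def, ← integral_prod_mul]
  refine integral_congr_ae ?_
  filter_upwards [tp_coe x y, tp_coe x' y'] with p h1 h2
  rw [h1, h2, RCLike.inner_apply, RCLike.inner_apply, RCLike.inner_apply, map_mul]
  ring

lemma tp_indicator {α : Set X} {β : Set Y} (hα : MeasurableSet α) (hβ : MeasurableSet β)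
    (h1 : μ α ≠ ∞) (h2 : ν β ≠ ∞) (h3 : (μ.prod ν) (α ×ˢ β) ≠ ∞) :
    tp (indicatorConstLp 2 hα h1 (1 : ℂ)) (indicatorConstLp 2 hβ h2 (1 : ℂ)) =
      indicatorConstLp 2 (hα.prod hβ) h3 (1 : ℂ) := by
  refine Lp.ext ?_
  have e1 : ∀ᵐ x ∂μ, (indicatorConstLp 2 hα h1 (1 : ℂ)) x = α.indicator (fun _ => (1 : ℂ)) x :=
    indicatorConstLp_coeFn
  have e2 : ∀ᵐ x ∂ν, (indicatorConstLp 2 hβ h2 (1 : ℂ)) x = β.indicator (fun _ => (1 : ℂ)) x :=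
    indicatorConstLp_coeFn
  filter_upwards [tp_coe (indicatorConstLp 2 hα h1 (1 : ℂ)) (indicatorConstLp 2 hβ h2 (1 : ℂ)),
    indicatorConstLp_coeFn (p := 2) (hs := hα.prod hβ) (hμs := h3) (c := (1 : ℂ)),
    ae_fst (ν := ν) e1, ae_snd (μ := μ) e2] with p a1 a2 a3 a4
  rw [a1, a2, a3, a4]
  by_cases ha : p.1 ∈ α <;> by_cases hb : p.2 ∈ β <;> simp [indicator, ha, hb]

lemma tp_total (z : Lp ℂ 2 (μ.prod ν)) (h : ∀ x y, ⟪tp x y, z⟫ = 0) : z = 0 := by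
  have key : ∀ q : ℕ × ℕ, ∀ᵐ p ∂((μ.prod ν).restrict (spanningSets μ q.1 ×ˢ spanningSets ν q.2)), z p = 0 := by
    intro q
    set A := spanningSets μ q.1
    set B := spanningSets ν q.2
    have mA : MeasurableSet A := measurableSet_spanningSets _ _
    have mB : MeasurableSet B := measurableSet_spanningSets _ _
    have fA : μ A < ∞ := measure_spanningSets_lt_top _ _
    have fB : ν B < ∞ := measure_spanningSets_lt_top _ _
    have fAB : (μ.prod ν) (A ×ˢ B) < ∞ := by
      rw [Measure.prod_prod]; exact ENNReal.mul_lt_top fA fB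
    haveI : IsFiniteMeasure ((μ.prod ν).restrict (A ×ˢ B)) :=
      ⟨by rwa [Measure.restrict_apply_univ]⟩
    have hi : Integrable z ((μ.prod ν).restrict (A ×ˢ B)) :=
      ((Lp.memLp z).restrict _).integrable (by norm_num)
    have hrect : ∀ α β, MeasurableSet α → MeasurableSet β →
        ∫ p in α ×ˢ β, z p ∂((μ.prod ν).restrict (A ×ˢ B)) = 0 := by
      intro α β ha hb
      rw [Measure.restrict_restrict (ha.prod hb), prod_inter_prod]
      have f1 : μ (α ∩ A) ≠ ∞ := ((measure_mono inter_subset_right).trans_lt fA).ne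
      have f2 : ν (β ∩ B) ≠ ∞ := ((measure_mono inter_subset_right).trans_lt fB).ne
      have f3 : (μ.prod ν) ((α ∩ A) ×ˢ (β ∩ B)) ≠ ∞ := by
        rw [Measure.prod_prod]; exact ENNReal.mul_ne_top f1 f2
      have := h (indicatorConstLp 2 (ha.inter mA) f1 1) (indicatorConstLp 2 (hb.inter mB) f2 1)
      rw [tp_indicator _ _ _ _ f3, L2.inner_indicatorConstLp_one] at this
      exact this
    have htot : ∫ p, z p ∂((μ.prod ν).restrict (A ×ˢ B)) = 0 := by
      have := hrect univ univ .univ .univ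
      rwa [univ_prod_univ, setIntegral_univ] at this
    refine hi.ae_eq_zero_of_forall_setIntegral_eq_zero fun s hs _ => ?_
    refine MeasurableSpace.induction_on_inter
      (C := fun s _ => ∫ p in s, z p ∂((μ.prod ν).restrict (A ×ˢ B)) = 0)
      generateFrom_prod.symm isPiSystem_prod ?_ ?_ ?_ ?_ s hs
    · exact setIntegral_empty
    · rintro _ ⟨t₁, ht₁, t₂, ht₂, rfl⟩
      exact hrect t₁ t₂ ht₁ ht₂
    · intro t ht h0
      have := integral_add_compl ht hi
      rw [h0, htot, zero_add] at this
      exact this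
    · intro f hd hm h0
      have := hasSum_integral_iUnion hm hd hi.integrableOn
      simp only [h0] at this
      exact this.unique hasSum_zero
  rw [← ae_restrict_iUnion_iff] at key
  have hu : ⋃ q : ℕ × ℕ, spanningSets μ q.1 ×ˢ spanningSets ν q.2 = univ := by
    refine eq_univ_of_forall fun p => mem_iUnion.2 ?_
    have h1 : p.1 ∈ ⋃ n, spanningSets μ n := by rw [iUnion_spanningSets]; trivial
    have h2 : p.2 ∈ ⋃ n, spanningSets ν n := by rw [iUnion_spanningSets]; trivial
    obtain ⟨i, hi⟩ := mem_iUnion.1 h1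
    obtain ⟨j, hj⟩ := mem_iUnion.1 h2
    exact ⟨(i, j), hi, hj⟩
  rw [hu, Measure.restrict_univ] at key
  refine Lp.ext ?_
  filter_upwards [key, Lp.coeFn_zero ℂ 2 (μ.prod ν)] with p h1 h2
  rw [h1, h2]; rfl

lemma tp_te : IsTensorEmbedding (tp : Lp ℂ 2 μ → Lp ℂ 2 ν → Lp ℂ 2 (μ.prod ν)) := by
  refine ⟨fun x x' y => ?_, fun x y y' => ?_, fun c x y => ?_, fun c x y => ?_, tp_inner, ?_⟩
  · refine Lp.ext ?_
    filter_upwards [tp_coe (x + x') y, tp_coe x y, tp_coe x' y, Lp.coeFn_add (tp x y) (tp x' y),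
      ae_fst (ν := ν) (Lp.coeFn_add x x')] with p a1 a2 a3 a4 a5
    rw [a1, a4, a5, Pi.add_apply, Pi.add_apply, a2, a3]; ring
  · refine Lp.ext ?_
    filter_upwards [tp_coe x (y + y'), tp_coe x y, tp_coe x y', Lp.coeFn_add (tp x y) (tp x y'),
      ae_snd (μ := μ) (Lp.coeFn_add y y')] with p a1 a2 a3 a4 a5
    rw [a1, a4, a5, Pi.add_apply, Pi.add_apply, a2, a3]; ring
  · refine Lp.ext ?_
    filter_upwards [tp_coe (c • x) y, tp_coe x y, Lp.coeFn_smul c (tp x y),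
      ae_fst (ν := ν) (Lp.coeFn_smul c x)] with p a1 a2 a3 a4
    rw [a1, a3, a4, Pi.smul_apply, Pi.smul_apply, a2, smul_eq_mul, smul_eq_mul]; ring
  · refine Lp.ext ?_
    filter_upwards [tp_coe x (c • y), tp_coe x y, Lp.coeFn_smul c (tp x y),
      ae_snd (μ := μ) (Lp.coeFn_smul c y)] with p a1 a2 a3 a4
    rw [a1, a3, a4, Pi.smul_apply, Pi.smul_apply, a2, smul_eq_mul, smul_eq_mul]; ring
  · rw [Submodule.topologicalClosure_eq_top_iff, Submodule.eq_bot_iff]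
    intro z hz
    refine tp_total z fun x y => ?_
    exact (Submodule.mem_orthogonal _ _).1 hz _ (Submodule.subset_span ⟨x, y, rfl⟩)

lemma lp_fin (ζ : Lp ℂ 2 (μ.prod ν)) :
    AEMeasurable (fun x => ∫⁻ y, ‖ζ (x, y)‖ₑ ^ 2 ∂ν) μ ∧
    ∫⁻ x, ∫⁻ y, ‖ζ (x, y)‖ₑ ^ 2 ∂ν ∂μ = ‖ζ‖ₑ ^ 2 := by
  have hm : AEMeasurable (fun p => ‖ζ p‖ₑ ^ 2) (μ.prod ν) :=
    (Lp.aestronglyMeasurable ζ).enorm.pow_const 2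
  refine ⟨hm.lintegral_prod_right', ?_⟩
  rw [lp_enorm_sq, lintegral_prod _ hm]

lemma ae_memLp_fib (ζ : Lp ℂ 2 (μ.prod ν)) : ∀ᵐ x ∂μ, MemLp (fun y => ζ (x, y)) 2 ν := by
  have h := lp_fin ζ
  have h3 : ∫⁻ x, ∫⁻ y, ‖ζ (x, y)‖ₑ ^ 2 ∂ν ∂μ ≠ ∞ := by
    rw [h.2]; exact (ENNReal.pow_lt_top enorm_lt_top).ne
  filter_upwards [ae_lt_top' h.1 h3, (Lp.aestronglyMeasurable ζ).prodMk_left] with x h1 h2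
  refine ⟨h2, ?_⟩
  rw [eLpNorm_lt_top_iff_lintegral_rpow_enorm_lt_top (by norm_num) (by norm_num)]
  simpa only [ENNReal.toReal_ofNat, ENNReal.rpow_ofNat] using h1

open Classical in
def fib (ζ : Lp ℂ 2 (μ.prod ν)) (x : X) : Lp ℂ 2 ν :=
  if h : MemLp (fun y => ζ (x, y)) 2 ν then h.toLp _ else 0

lemma fib_coe (ζ : Lp ℂ 2 (μ.prod ν)) : ∀ᵐ x ∂μ, fib ζ x =ᵐ[ν] fun y => ζ (x, y) := by
  filter_upwards [ae_memLp_fib ζ] with x hx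
  rw [fib, dif_pos hx]
  exact hx.coeFn_toLp

lemma fib_enorm (ζ : Lp ℂ 2 (μ.prod ν)) :
    (fun x => ‖fib ζ x‖ₑ ^ 2) =ᵐ[μ] fun x => ∫⁻ y, ‖ζ (x, y)‖ₑ ^ 2 ∂ν := by
  filter_upwards [fib_coe ζ] with x hx
  rw [lp_enorm_sq]
  refine lintegral_congr_ae ?_
  filter_upwards [hx] with y hy
  rw [hy]

lemma fib_lintegral (ζ : Lp ℂ 2 (μ.prod ν)) : ∫⁻ x, ‖fib ζ x‖ₑ ^ 2 ∂μ = ‖ζ‖ₑ ^ 2 := by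
  rw [lintegral_congr_ae (fib_enorm ζ), (lp_fin ζ).2]

lemma fib_aem (ζ : Lp ℂ 2 (μ.prod ν)) : AEMeasurable (fun x => ‖fib ζ x‖ₑ) μ := by
  have h : AEMeasurable (fun x => ‖fib ζ x‖ₑ ^ 2) μ := (lp_fin ζ).1.congr (fib_enorm ζ).symm
  have h2 := h.pow_const (1 / 2 : ℝ)
  refine h2.congr (Eventually.of_forall fun x => ?_)
  change (‖fib ζ x‖ₑ ^ 2) ^ (1 / 2 : ℝ) = _
  rw [← ENNReal.rpow_natCast, ← ENNReal.rpow_mul]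
  norm_num

lemma fib_sqS {ι : Type*} [Countable ι] {ξ : ι → Lp ℂ 2 (μ.prod ν)} (h : SqS ξ) :
    ∀ᵐ x ∂μ, SqS (fun n => fib (ξ n) x) := by
  refine ae_sqS_fun (fun n => fib_aem _) ?_
  simp only [fib_lintegral]
  exact (sqS_iff_enorm ξ).1 h

lemma sla_fib (e : Lp ℂ 2 ν) (ζ : Lp ℂ 2 (μ.prod ν)) :
    sla tp_te e ζ =ᵐ[μ] fun x => ⟪e, fib ζ x⟫ := by
  set G : X → ℂ := fun x => ∫ y, ⟪e y, ζ (x, y)⟫ ∂ν with hG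
  have hGe : (fun x => ⟪e, fib ζ x⟫) =ᵐ[μ] G := by
    filter_upwards [fib_coe ζ] with x hx
    rw [L2.inner_def]
    refine integral_congr_ae ?_
    filter_upwards [hx] with y hy
    rw [hy]
  have hm : AEStronglyMeasurable (fun p : X × Y => ⟪e p.2, ζ p⟫) (μ.prod ν) :=
    (Lp.aestronglyMeasurable e).comp_snd.inner (Lp.aestronglyMeasurable ζ)
  have hGm : AEStronglyMeasurable G μ := hm.integral_prod_right'
  have hGL : MemLp G 2 μ := by
    refine ⟨hGm, ?_⟩
    rw [eLpNorm_lt_top_iff_lintegral_rpow_enorm_lt_top (by norm_num) (by norm_num)]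
    simp only [ENNReal.toReal_ofNat, ENNReal.rpow_ofNat]
    calc ∫⁻ x, ‖G x‖ₑ ^ 2 ∂μ ≤ ∫⁻ x, ‖e‖ₑ ^ 2 * ‖fib ζ x‖ₑ ^ 2 ∂μ := by
          refine lintegral_mono_ae ?_
          filter_upwards [hGe] with x hx
          rw [← hx, ← mul_pow]
          gcongr
          rw [enorm_eq_nnnorm, enorm_eq_nnnorm, enorm_eq_nnnorm]
          exact_mod_cast nnnorm_inner_le_nnnorm (𝕜 := ℂ) e (fib ζ x)
      _ = ‖e‖ₑ ^ 2 * ‖ζ‖ₑ ^ 2 := by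
          rw [lintegral_const_mul' _ _ (ENNReal.pow_lt_top enorm_lt_top).ne, fib_lintegral]
      _ < ∞ := ENNReal.mul_lt_top (ENNReal.pow_lt_top enorm_lt_top) (ENNReal.pow_lt_top enorm_lt_top)
  have hEq : sla tp_te e ζ = hGL.toLp G := by
    refine ext_inner_left ℂ fun f => ?_
    rw [sla_inner, L2.inner_def, L2.inner_def, integral_prod _ (L2.integrable_inner (tp f e) ζ)]
    refine integral_congr_ae ?_
    filter_upwards [hGL.coeFn_toLp, Measure.ae_ae_of_ae_prod (tp_coe f e)] with x h1 h2
    rw [h1, RCLike.inner_apply, hG]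
    change _ = (∫ y, ⟪e y, ζ (x, y)⟫ ∂ν) * _
    rw [← integral_mul_const]
    refine integral_congr_ae ?_
    filter_upwards [h2] with y hy
    rw [hy, RCLike.inner_apply, RCLike.inner_apply, map_mul]
    ring
  rw [hEq]
  exact hGL.coeFn_toLp.trans hGe.symm

lemma hb_countable {K : Type*} [NormedAddCommGroup K] [InnerProductSpace ℂ K]
    [TopologicalSpace.SeparableSpace K] {ι : Type*} {e : ι → K} (he : Orthonormal ℂ e) : Countable ι := by
  refine Pairwise.countable_of_isOpen_disjoint (s := fun i => Metric.ball (e i) (1 / 2)) ?_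
    (fun i => Metric.isOpen_ball) (fun i => ⟨e i, Metric.mem_ball_self (by norm_num)⟩)
  intro i j hij
  refine Metric.ball_disjoint_ball ?_
  have h : ‖e i - e j‖ ^ 2 = 2 := by
    rw [@norm_sub_sq ℂ, he.2 hij, he.1, he.1]; norm_num
  rw [dist_eq_norm]
  nlinarith [norm_nonneg (e i - e j)]

end P8
end OpSynth

namespace OpSynth

section P9
open Filter
open scoped ENNReal ComplexConjugate

variable {X₁ X₂ Y₁ Y₂ : Type*} [MeasurableSpace X₁] [MeasurableSpace X₂] [MeasurableSpace Y₁]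
  [MeasurableSpace Y₂] {μ₁ : Measure X₁} {μ₂ : Measure X₂} {ν₁ : Measure Y₁} {ν₂ : Measure Y₂}
  [SigmaFinite μ₁] [SigmaFinite μ₂] [SigmaFinite ν₁] [SigmaFinite ν₂]
  {κ : Set (X₁ × X₂)} {lam : Set (Y₁ × Y₂)}

lemma mem_flip {p : (X₁ × Y₁) × (X₂ × Y₂)} : p ∈ flipProd '' (κ ×ˢ lam) ↔
    (p.1.1, p.2.1) ∈ κ ∧ (p.1.2, p.2.2) ∈ lam := by
  constructor
  · rintro ⟨q, ⟨h1, h2⟩, rfl⟩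
    exact ⟨h1, h2⟩
  · rintro ⟨h1, h2⟩
    exact ⟨((p.1.1, p.2.1), (p.1.2, p.2.2)), ⟨h1, h2⟩, rfl⟩

lemma ev_fst {P : X₁ × X₂ → Prop} (h : ∀ᶠ q in ae μ₁ ×ˢ ae μ₂, P q) :
    ∀ᶠ p in ae (μ₁.prod ν₁) ×ˢ ae (μ₂.prod ν₂), P (p.1.1, p.2.1) :=
  (Tendsto.prodMap (Measure.quasiMeasurePreserving_fst (μ := μ₁) (ν := ν₁)).tendsto_ae
    (Measure.quasiMeasurePreserving_fst (μ := μ₂) (ν := ν₂)).tendsto_ae).eventually h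

lemma ev_snd {P : Y₁ × Y₂ → Prop} (h : ∀ᶠ q in ae ν₁ ×ˢ ae ν₂, P q) :
    ∀ᶠ p in ae (μ₁.prod ν₁) ×ˢ ae (μ₂.prod ν₂), P (p.1.2, p.2.2) :=
  (Tendsto.prodMap (Measure.quasiMeasurePreserving_snd (μ := μ₁) (ν := ν₁)).tendsto_ae
    (Measure.quasiMeasurePreserving_snd (μ := μ₂) (ν := ν₂)).tendsto_ae).eventually h

lemma prop_aux {P Q a b c d : Prop} (hU : P ↔ c ∨ d) (hE : Q ↔ a ∨ b)
    (h1 : ¬((a ∧ ¬c) ∨ (c ∧ ¬a))) (h2 : ¬((b ∧ ¬d) ∨ (d ∧ ¬b))) :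
    ¬((Q ∧ ¬P) ∨ (P ∧ ¬Q)) := by
  rw [hU, hE]; tauto

lemma omegaClosed_flip (h1 : OmegaClosed μ₁ μ₂ κ) (h2 : OmegaClosed ν₁ ν₂ lam) :
    OmegaClosed (μ₁.prod ν₁) (μ₂.prod ν₂) (flipProd '' (κ ×ˢ lam)) := by
  obtain ⟨α, β, ha, hb, he⟩ := h1
  obtain ⟨γ, δ, hc, hd, hf⟩ := h2
  unfold MargEquiv at he hf
  rw [margNull_iff] at he hf
  refine ⟨mergeS (fun n => α n ×ˢ univ) (fun n => univ ×ˢ γ n),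
    mergeS (fun n => β n ×ˢ univ) (fun n => univ ×ˢ δ n), ?_, ?_, ?_⟩
  · intro n
    unfold mergeS
    rw [Function.comp_apply]
    cases Equiv.natSumNatEquivNat.symm n with
    | inl m => exact (ha m).prod .univ
    | inr m => exact MeasurableSet.univ.prod (hc m)
  · intro n
    unfold mergeS
    rw [Function.comp_apply]
    cases Equiv.natSumNatEquivNat.symm n with
    | inl m => exact (hb m).prod .univ
    | inr m => exact MeasurableSet.univ.prod (hd m)
  · unfold MargEquiv
    rw [margNull_iff]
    filter_upwards [ev_fst (ν₁ := ν₁) (ν₂ := ν₂) he, ev_snd (μ₁ := μ₁) (μ₂ := μ₂) hf] with p a1 a2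
    have hU : p ∈ (⋃ n, mergeS (fun n => α n ×ˢ univ) (fun n => univ ×ˢ γ n) n ×ˢ
        mergeS (fun n => β n ×ˢ univ) (fun n => univ ×ˢ δ n) n) ↔
        (p.1.1, p.2.1) ∈ (⋃ n, α n ×ˢ β n) ∨ (p.1.2, p.2.2) ∈ (⋃ n, γ n ×ˢ δ n) := by
      simp only [mem_iUnion]
      constructor
      · rintro ⟨n, hn⟩
        unfold mergeS at hn
        rw [Function.comp_apply, Function.comp_apply] at hn
        cases h : Equiv.natSumNatEquivNat.symm n with
        | inl m => rw [h] at hn; exact Or.inl ⟨m, hn.1.1, hn.2.1⟩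
        | inr m => rw [h] at hn; exact Or.inr ⟨m, hn.1.2, hn.2.2⟩
      · rintro (⟨m, hm⟩ | ⟨m, hm⟩)
        · refine ⟨Equiv.natSumNatEquivNat (Sum.inl m), ?_⟩
          unfold mergeS
          rw [Function.comp_apply, Function.comp_apply, Equiv.symm_apply_apply]
          exact ⟨⟨hm.1, trivial⟩, ⟨hm.2, trivial⟩⟩
        · refine ⟨Equiv.natSumNatEquivNat (Sum.inr m), ?_⟩
          unfold mergeS
          rw [Function.comp_apply, Function.comp_apply, Equiv.symm_apply_apply]
          exact ⟨⟨trivial, hm.1⟩, ⟨trivial, hm.2⟩⟩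
    have hE : p ∈ (flipProd '' (κ ×ˢ lam))ᶜ ↔ (p.1.1, p.2.1) ∈ κᶜ ∨ (p.1.2, p.2.2) ∈ lamᶜ := by
      rw [mem_compl_iff, mem_flip, mem_compl_iff, mem_compl_iff]; tauto
    exact prop_aux hU hE a1 a2

lemma slice_fst {A : Lp ℂ 2 (μ₁.prod ν₁) →L[ℂ] Lp ℂ 2 (μ₂.prod ν₂)}
    (hA : A ∈ Mmax (μ₁.prod ν₁) (μ₂.prod ν₂) (flipProd '' (κ ×ˢ lam))) (y : Lp ℂ 2 ν₁) (y' : Lp ℂ 2 ν₂) :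
    sla (tp_te (μ := μ₂)) y' ∘L A ∘L sl (tp_te (μ := μ₁)) y ∈ Mmax μ₁ μ₂ κ := by
  rw [mem_Mmax_iff] at hA ⊢
  intro α β ha hb hn f g hf hg
  change ⟪g, sla tp_te y' (A (tp f y))⟫ = 0
  rw [sla_inner]
  refine hA (α ×ˢ univ) (β ×ˢ univ) (ha.prod .univ) (hb.prod .univ) ?_ _ _ ?_ ?_
  · rw [margNull_iff] at hn ⊢
    filter_upwards [ev_fst (ν₁ := ν₁) (ν₂ := ν₂) hn] with p hp h
    exact hp ⟨⟨h.1.1.1, h.1.2.1⟩, (mem_flip.1 h.2).1⟩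
  · filter_upwards [tp_coe f y, ae_fst (ν := ν₁) hf] with p h1 h2 h3
    rw [h1, h2 fun h => h3 ⟨h, trivial⟩, zero_mul]
  · filter_upwards [tp_coe g y', ae_fst (ν := ν₂) hg] with p h1 h2 h3
    rw [h1, h2 fun h => h3 ⟨h, trivial⟩, zero_mul]

lemma slice_snd {A : Lp ℂ 2 (μ₁.prod ν₁) →L[ℂ] Lp ℂ 2 (μ₂.prod ν₂)}
    (hA : A ∈ Mmax (μ₁.prod ν₁) (μ₂.prod ν₂) (flipProd '' (κ ×ˢ lam))) (y : Lp ℂ 2 μ₁) (y' : Lp ℂ 2 μ₂) :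
    sla (te_swap (tp_te (μ := μ₂) (ν := ν₂))) y' ∘L A ∘L sl (te_swap (tp_te (μ := μ₁) (ν := ν₁))) y ∈
      Mmax ν₁ ν₂ lam := by
  rw [mem_Mmax_iff] at hA ⊢
  intro α β ha hb hn f g hf hg
  change ⟪g, sla (te_swap tp_te) y' (A (tp y f))⟫ = 0
  rw [sla_inner]
  refine hA (univ ×ˢ α) (univ ×ˢ β) (MeasurableSet.univ.prod ha) (MeasurableSet.univ.prod hb) ?_ _ _ ?_ ?_
  · rw [margNull_iff] at hn ⊢
    filter_upwards [ev_snd (μ₁ := μ₁) (μ₂ := μ₂) hn] with p hp h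
    exact hp ⟨⟨h.1.1.2, h.1.2.2⟩, (mem_flip.1 h.2).2⟩
  · filter_upwards [tp_coe y f, ae_snd (μ := μ₁) hf] with p h1 h2 h3
    rw [h1, h2 fun h => h3 ⟨trivial, h⟩, mul_zero]
  · filter_upwards [tp_coe y' g, ae_snd (μ := μ₂) hg] with p h1 h2 h3
    rw [h1, h2 fun h => h3 ⟨trivial, h⟩, mul_zero]

lemma Mmax_sub_Fubini : Mmax (μ₁.prod ν₁) (μ₂.prod ν₂) (flipProd '' (κ ×ˢ lam)) ⊆
    Fubini tp tp (Mmax μ₁ μ₂ κ) (Mmax ν₁ ν₂ lam) := by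
  intro A hA
  refine ⟨mem_wTensor_of_slices tp_te tp_te (slice_fst hA), ?_⟩
  have := mem_wTensor_of_slices (te_swap tp_te) (te_swap tp_te) (slice_snd hA)
  rw [wTensor_swap] at this
  exact this

lemma fib_ker {ξ : ℕ → Lp ℂ 2 (μ₁.prod ν₁)} {η : ℕ → Lp ℂ 2 (μ₂.prod ν₂)}
    (hk : KerRep (μ₁.prod ν₁) (μ₂.prod ν₂) (flipProd '' (κ ×ˢ lam)) ξ η 0) :
    ∀ᶠ p in ae μ₁ ×ˢ ae μ₂, p ∈ κ →
      KerRep ν₁ ν₂ lam (fun n => fib (ξ n) p.1) (fun n => fib (η n) p.2) 0 := by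
  unfold KerRep at hk
  rw [eventually_prod_iff] at hk
  obtain ⟨pa, ha, pb, hb, hab⟩ := hk
  have f1 : ∀ᵐ x ∂μ₁, ∀ n, fib (ξ n) x =ᵐ[ν₁] fun y => ξ n (x, y) := ae_all_iff.2 fun n => fib_coe _
  have f2 : ∀ᵐ x ∂μ₂, ∀ n, fib (η n) x =ᵐ[ν₂] fun y => η n (x, y) := ae_all_iff.2 fun n => fib_coe _
  filter_upwards [(Measure.ae_ae_of_ae_prod ha).prod_inl _, (Measure.ae_ae_of_ae_prod hb).prod_inr _,
    f1.prod_inl _, f2.prod_inr _] with p a1 a2 a3 a4 hp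
  have b3 : ∀ᵐ y ∂ν₁, ∀ n, fib (ξ n) p.1 y = ξ n (p.1, y) := ae_all_iff.2 a3
  have b4 : ∀ᵐ y ∂ν₂, ∀ n, fib (η n) p.2 y = η n (p.2, y) := ae_all_iff.2 a4
  unfold KerRep
  filter_upwards [a1.prod_inl _, a2.prod_inr _, b3.prod_inl _, b4.prod_inr _] with q c1 c2 c3 c4 hq
  have := hab c1 c2 (mem_flip.2 ⟨hp, hq⟩)
  simp only [c3, c4]
  exact this

lemma sqS_a {J : Type*} [Countable J] (e : HilbertBasis J ℂ (Lp ℂ 2 ν₂)) (R : Lp ℂ 2 ν₁ →L[ℂ] Lp ℂ 2 ν₂)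
    {ξ : ℕ → Lp ℂ 2 (μ₁.prod ν₁)} (hξ : SqS ξ) :
    SqS (fun q : ℕ × J => sla (tp_te (μ := μ₁)) (ContinuousLinearMap.adjoint R (e q.2)) (ξ q.1)) := by
  rw [sqS_iff_enorm]
  rw [ENNReal.tsum_prod']
  have hb : ∀ n, ∑' j, ‖sla (tp_te (μ := μ₁)) (ContinuousLinearMap.adjoint R (e j)) (ξ n)‖ₑ ^ 2 ≤
      ‖R‖ₑ ^ 2 * ‖ξ n‖ₑ ^ 2 := by
    intro n
    have hall : ∀ᵐ x ∂μ₁, ∀ j, sla (tp_te (μ := μ₁)) (ContinuousLinearMap.adjoint R (e j)) (ξ n) x =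
        ⟪e j, R (fib (ξ n) x)⟫ := by
      refine ae_all_iff.2 fun j => ?_
      filter_upwards [sla_fib (ContinuousLinearMap.adjoint R (e j)) (ξ n)] with x hx
      rw [hx, ContinuousLinearMap.adjoint_inner_left]
    simp only [lp_enorm_sq]
    rw [← lintegral_tsum fun j => (Lp.aestronglyMeasurable _).enorm.pow_const 2, ← lp_enorm_sq,
      ← fib_lintegral, ← lintegral_const_mul' _ _ (ENNReal.pow_lt_top enorm_lt_top).ne]
    refine lintegral_mono_ae ?_
    filter_upwards [hall] with x hx
    simp only [hx]
    have hB : HasSum (fun j => ‖⟪e j, R (fib (ξ n) x)⟫‖ ^ 2) (‖R (fib (ξ n) x)‖ ^ 2) := by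
      have h := lp.hasSum_norm (p := 2) (by norm_num) (e.repr (R (fib (ξ n) x)))
      simp only [ENNReal.toReal_ofNat, Real.rpow_ofNat, HilbertBasis.repr_apply_apply,
        LinearIsometryEquiv.norm_map] at h
      exact h
    calc ∑' j, ‖⟪e j, R (fib (ξ n) x)⟫‖ₑ ^ 2 = ENNReal.ofReal (‖R (fib (ξ n) x)‖ ^ 2) := by
          rw [← hB.tsum_eq, ENNReal.ofReal_tsum_of_nonneg (fun n => by positivity) hB.summable]
          exact tsum_congr fun n => enorm_sq_eq_ofReal _
      _ ≤ ENNReal.ofReal (‖R‖ ^ 2 * ‖fib (ξ n) x‖ ^ 2) := by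
          apply ENNReal.ofReal_le_ofReal
          rw [← mul_pow]
          gcongr
          exact R.le_opNorm _
      _ = _ := by
          rw [ENNReal.ofReal_mul (by positivity), enorm_sq_eq_ofReal, enorm_sq_eq_ofReal]
  have : ∑' n, ‖R‖ₑ ^ 2 * ‖ξ n‖ₑ ^ 2 ≠ ∞ := by
    rw [ENNReal.tsum_mul_left]
    exact ENNReal.mul_ne_top (ENNReal.pow_lt_top enorm_lt_top).ne ((sqS_iff_enorm ξ).1 hξ)
  exact ne_top_of_le_ne_top this (ENNReal.tsum_le_tsum hb)

lemma sqS_b {J : Type*} [Countable J] (e : HilbertBasis J ℂ (Lp ℂ 2 ν₂))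
    {η : ℕ → Lp ℂ 2 (μ₂.prod ν₂)} (hη : SqS η) :
    SqS (fun q : ℕ × J => sla (tp_te (μ := μ₂)) (e q.2) (η q.1)) := by
  have := sqS_a (μ₁ := μ₂) e (ContinuousLinearMap.id ℂ (Lp ℂ 2 ν₂)) hη
  rw [show ContinuousLinearMap.adjoint (ContinuousLinearMap.id ℂ (Lp ℂ 2 ν₂)) = ContinuousLinearMap.id ℂ _ from
    ContinuousLinearMap.adjoint_id] at this
  exact this

lemma elem_mem [TopologicalSpace.SeparableSpace (Lp ℂ 2 ν₂)]
    (hκ : OperatorSynthetic μ₁ μ₂ κ) (hl : OperatorSynthetic ν₁ ν₂ lam)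
    {U : Set (Lp ℂ 2 (μ₁.prod ν₁) →L[ℂ] Lp ℂ 2 (μ₂.prod ν₂))}
    (hU : IsMultBimodule (μ₁.prod ν₁) (μ₂.prod ν₂) U)
    (hR : RefHull U = Mmax (μ₁.prod ν₁) (μ₂.prod ν₂) (flipProd '' (κ ×ˢ lam)))
    {W : Lp ℂ 2 (μ₁.prod ν₁) →L[ℂ] Lp ℂ 2 (μ₂.prod ν₂)} {S : Lp ℂ 2 μ₁ →L[ℂ] Lp ℂ 2 μ₂}
    {R : Lp ℂ 2 ν₁ →L[ℂ] Lp ℂ 2 ν₂} (hS : S ∈ Mmax μ₁ μ₂ κ) (hRm : R ∈ Mmax ν₁ ν₂ lam)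
    (hW : IsElemTensor tp tp W S R) : W ∈ U := by
  by_contra hWU
  obtain ⟨ξ, η, hξ, hη, h0, h1⟩ := exists_sep hU.1 hWU
  apply h1
  have hker := lemma_A hU hR hξ hη h0
  obtain ⟨J, e, -⟩ := exists_hilbertBasis ℂ (Lp ℂ 2 ν₂)
  haveI : Countable J := hb_countable e.orthonormal
  set a : ℕ × J → Lp ℂ 2 μ₁ := fun q => sla (tp_te (μ := μ₁)) (ContinuousLinearMap.adjoint R (e q.2)) (ξ q.1) with ha
  set b : ℕ × J → Lp ℂ 2 μ₂ := fun q => sla (tp_te (μ := μ₂)) (e q.2) (η q.1) with hb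
  have sa : SqS a := sqS_a e R hξ
  have sb : SqS b := sqS_b e hη
  have hWs : ∀ j, sla (tp_te (μ := μ₂)) (e j) ∘L W =
      S ∘L sla (tp_te (μ := μ₁)) (ContinuousLinearMap.adjoint R (e j)) := by
    intro j
    refine te_ext tp_te fun x y => ?_
    change sla tp_te (e j) (W (tp x y)) = S (sla tp_te _ (tp x y))
    rw [hW x y, sla_apply, sla_apply, map_smul, ContinuousLinearMap.adjoint_inner_left]
  have hsum : ∑' n, ⟪η n, W (ξ n)⟫ = ∑' q, ⟪b q, S (a q)⟫ := by
    rw [(sa.pair sb S).tsum_prod]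
    refine tsum_congr fun n => ?_
    rw [← (sla_hasSum_inner tp_te e (η n) (W (ξ n))).tsum_eq]
    refine tsum_congr fun j => ?_
    have := congrArg (fun A => A (ξ n)) (hWs j)
    change sla tp_te (e j) (W (ξ n)) = S (a (n, j)) at this
    rw [this]
  rw [hsum]
  refine lemma_M hκ hS sa sb ?_
  have ea : ∀ᵐ x ∂μ₁, ∀ q : ℕ × J, a q x = ⟪e q.2, R (fib (ξ q.1) x)⟫ := by
    refine ae_all_iff.2 fun q => ?_
    filter_upwards [sla_fib (ContinuousLinearMap.adjoint R (e q.2)) (ξ q.1)] with x hx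
    rw [ha]
    simp only
    rw [hx, ContinuousLinearMap.adjoint_inner_left]
  have eb : ∀ᵐ x ∂μ₂, ∀ q : ℕ × J, b q x = ⟪e q.2, fib (η q.1) x⟫ := by
    refine ae_all_iff.2 fun q => ?_
    filter_upwards [sla_fib (e q.2) (η q.1)] with x hx
    exact hx
  unfold KerRep
  filter_upwards [fib_ker hker, (fib_sqS hξ).prod_inl _, (fib_sqS hη).prod_inr _, ea.prod_inl _,
    eb.prod_inr _, (ae_sqS sa).prod_inl _, (ae_sqS sb).prod_inr _] with p c1 c2 c3 c4 c5 c6 c7 hp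
  have hM := lemma_M hl hRm c2 c3 (c1 hp)
  have hs := sqS_mul c6 c7
  have ht : ∑' q, a q p.1 * conj (b q p.2) = 0 := by
    rw [hs.tsum_prod, ← hM]
    refine tsum_congr fun n => ?_
    rw [← (e.hasSum_inner_mul_inner (fib (η n) p.2) (R (fib (ξ n) p.1))).tsum_eq]
    refine tsum_congr fun j => ?_
    rw [c4, c5, inner_conj_symm, mul_comm]
  have hh := hs.hasSum
  rw [ht] at hh
  exact hh

end P9
end OpSynth

/-- Corollary `c_synps`. -/
theorem statement14
    (X₁ X₂ : Type)
    [MeasurableSpace X₁] [StandardBorelSpace X₁]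
    [MeasurableSpace X₂] [StandardBorelSpace X₂]
    (μ₁ : Measure X₁) (μ₂ : Measure X₂)
    [SigmaFinite μ₁] [SigmaFinite μ₂]
    (κ : Set (X₁ × X₂))
    (hκ : OperatorSynthetic μ₁ μ₂ κ)
    (hS : HasSsigma (Mmax μ₁ μ₂ κ)) :
    ∀ (Y₁ Y₂ : Type)
      [MeasurableSpace Y₁] [StandardBorelSpace Y₁]
      [MeasurableSpace Y₂] [StandardBorelSpace Y₂]
      (ν₁ : Measure Y₁) (ν₂ : Measure Y₂)
      [SigmaFinite ν₁] [SigmaFinite ν₂]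
      (lam : Set (Y₁ × Y₂)), OperatorSynthetic ν₁ ν₂ lam →
      OperatorSynthetic (μ₁.prod ν₁) (μ₂.prod ν₂) (flipProd '' (κ ×ˢ lam)) := by
  intro Y₁ Y₂ _ _ _ _ ν₁ ν₂ _ _ lam hl
  have hcl := omegaClosed_flip hκ.1 hl.1
  haveI : Fact ((2 : ENNReal) ≠ ⊤) := ⟨by norm_num⟩
  haveI : TopologicalSpace.SeparableSpace (Lp ℂ 2 ν₂) := inferInstance
  refine ⟨hcl, Subset.antisymm (sInter_subset_of_mem ⟨Mmax_bimodule, hcl, refHull_Mmax⟩) ?_⟩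
  refine subset_sInter ?_
  rintro U ⟨hU, -, hR⟩
  refine Mmax_sub_Fubini.trans ?_
  rw [hS _ _ _ _ tp tp tp_te tp_te _ Mmax_wk]
  obtain ⟨⟨M, hM⟩, hc⟩ := hU.1
  unfold wTensor wkClosure
  letI := sigmaWeak (Lp ℂ 2 (μ₁.prod ν₁)) (Lp ℂ 2 (μ₂.prod ν₂))
  refine closure_minimal ?_ hc
  rw [← hM]
  refine (Submodule.span_le (p := M)).2 ?_
  rintro W ⟨S, h1, R, h2, h3⟩
  change W ∈ (M : Set _)
  rw [hM]
  exact elem_mem hκ hl hU hR h1 h2 h3
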